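/- Rank-two evaluation (Theorem 6.2): Consider the type B/C lattice model of rank 2 with partition λ = (λ₁ ≥ λ₂ ≥ 0) and bend weights satisfying either (regime 1(a)): Bᵢ = Cᵢ with Aᵢ, Cᵢ, Dᵢ ∈ ℂ[q] for i = 1, 2, Cᵢ ≠ 0, and q²(A₁D₂ − C₁C₂) = A₂D₁ − C₁C₂ [set δ = 1 and κ = C₁C₂], or (regime 2(b)): Cᵢ = mᵢ·xᵢ⁻¹ and Bᵢ = q·mᵢ·xᵢ with mᵢ, Aᵢ, Dᵢ ∈ ℂ[q], mᵢ ≠ 0, and q³m₁m₂ + q²D₂A₁ − q·m₁m₂ − A₂D₁ = 0 [set δ = 0 and κ = m₁m₂]. Then Z_λ = (κ/c_λ(q))·Σ_{w∈W} w( x₁^{λ₁+δ}·x₂^{λ₂+δ}·∏_{t∈T} (1−q·t)/(1−t) ) + (A₁D₂/c_λ(q))·[ Σ_{w∈W} w(E₁) + (1/2)·Σ_{w∈W} w(E₂) ], where T = { x₂/x₁, (x₁x₂)⁻¹, x₁⁻², x₂⁻² }, E₁ = x₁^{λ₁+1}x₂^{λ₂+1} · (x₁−qx₂)/(x₁−x₂)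 · (x₂−qx̄₁)/(x₂−x̄₁) · (1−q)x̄₂/(x₁−x̄₂) · (x₁−qx̄₁)/(x₁−x̄₁) · (x₂−qx̄₂)/(x₂−x̄₂), E₂ = x₁^{λ₁−λ₂} · (x₁−qx₂)/(x₁−x₂) · (x̄₁−qx₂)/(x̄₁−x₂) · (x₁−qx̄₂)/(x₁−x̄₂) · (x̄₁−qx̄₂)/(x̄₁−x̄₂) · (x₁−qx̄₁)/(x₁−x̄₁) (E₂ is invariant under x₂ ↦ x₂⁻¹, so (1/2)Σ_{w∈W}w(E₂) equals the sum over W modulo the subgroup generated by that inversion), and c_λ(q) = 1 if λ₁ > λ₂ and c_λ(q) = 1 + q if λ₁ = λ₂. -/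

import Mathlib

noncomputable section

/-- Bosonic six-vertex Boltzmann weight `w_z(h_l, h_r, a, b)` (left horizontal label,
right horizontal label, top vertical multiplicity, bottom vertical multiplicity). -/
def sixw {F : Type} [Field F] (q z : F) : Bool → Bool → ℕ → ℕ → F
  | false, false, a, b => if a = b then 1 else 0
  | true,  true,  a, b => if a = b then z else 0
  | false, true,  a, b => if a = b + 1 then 1 - q ^ a else 0
  | true,  false, a, b => if b = a + 1 then z else 0

/-- Bend weight selector; the arguments are the left-boundary labels of the two rows
meeting the bend (top row of the pair first, bottom row second). -/
def bendw {F : Type} [Field F] (A B C D : F) : Bool → Bool → F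
  | false, false => A
  | true,  false => C
  | false, true  => B
  | true,  true  => D

/-- A state of the type B/C lattice model of rank `r` with bottom boundary given by the
partition `lam` and `L+1` columns: `m s c` is the multiplicity on the vertical edge
below row `s` (0-indexed from the bottom) in column `c`, and `h s c` is the occupancy of
the horizontal edge to the left of column `c` in row `s`. -/
structure BCState (r : ℕ) (lam : Fin r → ℕ) (L : ℕ) where
  m : Fin (2*r+1) → Fin (L+1) → ℕ
  h : Fin (2*r) → Fin (L+2) → Bool
  bottom : ∀ c : Fin (L+1), m 0 c = (Finset.univ.filter (fun i => lam i = c.val)).card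
  top : ∀ c : Fin (L+1), m (Fin.last (2*r)) c = 0
  right : ∀ s : Fin (2*r), h s (Fin.last (L+1)) = false

/-- The spectral parameter of row `s` (0-indexed from the bottom): row `2i-1` (1-indexed)
carries `xᵢ⁻¹` and row `2i` carries `xᵢ`. -/
def rowp {F : Type} [Field F] {r : ℕ} (x : Fin r → F) (s : Fin (2*r)) : F :=
  if s.val % 2 = 0 then (x ⟨s.val / 2, by have := s.isLt; omega⟩)⁻¹
  else x ⟨s.val / 2, by have := s.isLt; omega⟩

/-- The Boltzmann weight of a state: the product of the six-vertex weights at all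
tetravalent vertices times the product of the bend weights. -/
def stateWeight {F : Type} [Field F] {r : ℕ} {lam : Fin r → ℕ} {L : ℕ}
    (q : F) (x : Fin r → F) (A B C D : Fin r → F) (st : BCState r lam L) : F :=
  (∏ s : Fin (2*r), ∏ c : Fin (L+1),
      sixw q (rowp x s) (st.h s c.castSucc) (st.h s c.succ)
        (st.m s.succ c) (st.m s.castSucc c)) *
  ∏ i : Fin r,
      bendw (A i) (B i) (C i) (D i)
        (st.h ⟨2*i.val+1, by have := i.isLt; omega⟩ 0)
        (st.h ⟨2*i.val, by have := i.isLt; omega⟩ 0)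

/-- The partition function of the type B/C lattice model: the sum of the weights of all
states (only finitely many have nonzero weight). -/
def ZBC {F : Type} [Field F] {r : ℕ} (lam : Fin r → ℕ) (L : ℕ)
    (q : F) (x : Fin r → F) (A B C D : Fin r → F) : F :=
  ∑ᶠ st : BCState r lam L, stateWeight q x A B C D st

/-- `ℂ(q, x₁, x₂)`. -/
abbrev F2 : Type := FractionRing (MvPolynomial (Fin 3) ℂ)

/-- The element `q` of `ℂ(q, x₁, x₂)`. -/
def q2 : F2 := algebraMap (MvPolynomial (Fin 3) ℂ) F2 (MvPolynomial.X 0)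

/-- The elements `x₁, x₂` of `ℂ(q, x₁, x₂)`. -/
def x2v (i : Fin 2) : F2 :=
  algebraMap (MvPolynomial (Fin 3) ℂ) F2 (MvPolynomial.X i.succ)

/-- The embedding of the constants `ℂ`. -/
def cC2 : ℂ →+* F2 :=
  (algebraMap (MvPolynomial (Fin 3) ℂ) F2).comp MvPolynomial.C

/-- `a` lies in `ℂ[q] ⊆ ℂ(q, x₁, x₂)`. -/
def IsPolyQ2 (a : F2) : Prop :=
  ∃ p : Polynomial ℂ, a = Polynomial.eval₂ cC2 q2 p

/-- The sum `Σ_{w ∈ W} w(f)` over the hyperoctahedral group `W` of rank 2 (order 8),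
where `f` is given by the formula `g` evaluated at `(x₁, x₂)`: the action of `w` is by
permuting the variables and inverting a subset of them. -/
def WSum2 (g : (Fin 2 → F2) → F2) : F2 :=
  ∑ σ : Equiv.Perm (Fin 2), ∑ ε : Fin 2 → Bool,
    g fun i => if ε i then (x2v (σ i))⁻¹ else x2v (σ i)

/-- The product `∏_{t ∈ T} (1 − q·t)/(1 − t)` with
`T = {x₂/x₁, (x₁x₂)⁻¹, x₁⁻², x₂⁻²}`, evaluated at variables `y`. -/
def Tprod2 (y : Fin 2 → F2) : F2 :=
  ((1 - q2 * (y 1 / y 0)) / (1 - y 1 / y 0)) *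
  ((1 - q2 * (y 0 * y 1)⁻¹) / (1 - (y 0 * y 1)⁻¹)) *
  ((1 - q2 * (y 0 ^ 2)⁻¹) / (1 - (y 0 ^ 2)⁻¹)) *
  ((1 - q2 * (y 1 ^ 2)⁻¹) / (1 - (y 1 ^ 2)⁻¹))

/-- The expression `E₁` of Theorem 6.2, evaluated at variables `y`. -/
def E1 (l1 l2 : ℕ) (y : Fin 2 → F2) : F2 :=
  y 0 ^ (l1 + 1) * y 1 ^ (l2 + 1) *
  ((y 0 - q2 * y 1) / (y 0 - y 1)) *
  ((y 1 - q2 * (y 0)⁻¹) / (y 1 - (y 0)⁻¹)) *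
  ((1 - q2) * (y 1)⁻¹ / (y 0 - (y 1)⁻¹)) *
  ((y 0 - q2 * (y 0)⁻¹) / (y 0 - (y 0)⁻¹)) *
  ((y 1 - q2 * (y 1)⁻¹) / (y 1 - (y 1)⁻¹))

/-- The expression `E₂` of Theorem 6.2, evaluated at variables `y`. -/
def E2 (l1 l2 : ℕ) (y : Fin 2 → F2) : F2 :=
  y 0 ^ (l1 - l2) *
  ((y 0 - q2 * y 1) / (y 0 - y 1)) *
  (((y 0)⁻¹ - q2 * y 1) / ((y 0)⁻¹ - y 1)) *
  ((y 0 - q2 * (y 1)⁻¹) / (y 0 - (y 1)⁻¹)) *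
  (((y 0)⁻¹ - q2 * (y 1)⁻¹) / ((y 0)⁻¹ - (y 1)⁻¹)) *
  ((y 0 - q2 * (y 0)⁻¹) / (y 0 - (y 0)⁻¹))

/-! ### Reduction of the partition function to column transfer matrices -/

/-- Vertical multiplicity above a vertex, determined by conservation. -/
def upm (l r : Bool) (b : ℕ) : ℕ := b + r.toNat - l.toNat

/-- Vertical multiplicities along a column, determined by the horizontal labels. -/
def mm {n : ℕ} (l r : Fin n → Bool) (b : ℕ) : Fin (n + 1) → ℕ :=
  Fin.induction b (fun s m => upm (l s) (r s) m)

/-- Weight of a column with horizontal labels `l`, `r` and bottom multiplicity `b`. -/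
def colW {F : Type} [Field F] {n : ℕ} (q : F) (z : Fin n → F) (b : ℕ) (l r : Fin n → Bool) : F :=
  if mm l r b (Fin.last n) = 0 then
    ∏ s : Fin n, sixw q (z s) (l s) (r s) (mm l r b s.succ) (mm l r b s.castSucc) else 0

theorem sixw_ne_zero {F : Type} [Field F] {q z : F} {l r : Bool} {a b : ℕ}
    (h : sixw q z l r a b ≠ 0) : a = upm l r b := by
  cases l <;> cases r <;> simp [sixw, upm] at h ⊢ <;> omega

theorem mm_unique {n : ℕ} (l r : Fin n → Bool) (b : ℕ) (m : Fin (n + 1) → ℕ) (h0 : m 0 = b)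
    (hs : ∀ s : Fin n, m s.succ = upm (l s) (r s) (m s.castSucc)) (s : Fin (n + 1)) :
    m s = mm l r b s := by
  induction s using Fin.induction with
  | zero => simpa [mm] using h0
  | succ s ih => rw [hs, ih]; simp [mm]

/-- Left-to-right iteration of column transfer matrices. -/
def iterT {F S : Type} [Field F] [Fintype S] (K : ℕ → S → S → F) (β : S → F) : ℕ → S → F
  | 0, s => β s
  | n + 1, s => ∑ l, iterT K β n l * K n l s

theorem path_sum {F S : Type} [Field F] [Fintype S] [DecidableEq S]
    (K : ℕ → S → S → F) (β : S → F) (n : ℕ) (s0 : S) :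
    (∑ h : Fin (n + 1) → S, if h (Fin.last n) = s0 then
      (∏ c : Fin n, K c.val (h c.castSucc) (h c.succ)) * β (h 0) else 0) = iterT K β n s0 := by
  induction n generalizing s0 with
  | zero =>
    rw [← (Equiv.funUnique (Fin 1) S).symm.sum_comp]
    simp [iterT]
  | succ n ih =>
    rw [← (Fin.snocEquiv (fun _ : Fin (n + 2) => S)).sum_comp, Fintype.sum_prod_type]
    simp only [Fin.snocEquiv_apply, Fin.snoc_last]
    rw [Finset.sum_eq_single s0]
    · simp only [if_true, iterT, ← ih]
      simp only [Finset.sum_mul]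
      rw [Finset.sum_comm]
      refine Finset.sum_congr rfl fun h _ => ?_
      rw [Finset.sum_eq_single (h (Fin.last n))]
      · rw [Fin.prod_univ_castSucc]
        have e0 : (Fin.snoc h s0 : Fin (n + 2) → S) 0 = h 0 := by
          rw [show (0 : Fin (n + 2)) = (0 : Fin (n + 1)).castSucc from rfl, Fin.snoc_castSucc (α := fun _ => S)]
        have e1 : ∀ c : Fin n, (Fin.snoc h s0 : Fin (n + 2) → S) c.castSucc.succ = h c.succ := by
          intro c
          rw [← Fin.castSucc_succ, Fin.snoc_castSucc (α := fun _ => S)]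
        have e2 : ∀ c : Fin (n + 1), (Fin.snoc h s0 : Fin (n + 2) → S) c.castSucc = h c := by
          intro c
          rw [Fin.snoc_castSucc (α := fun _ => S)]
        have e3 : (Fin.snoc h s0 : Fin (n + 2) → S) (Fin.last n).succ = s0 := by
          rw [Fin.succ_last, Fin.snoc_last (α := fun _ => S)]
        simp only [e0, e1, e2, e3, if_true, Fin.val_castSucc, Fin.val_last]
        ring
      · intro b _ hb
        simp [hb.symm]
      · simp
    · intro b _ hb
      simp [hb]
    · simp

/-- The bend factor as a function of the left boundary labels. -/
def bendW {F : Type} [Field F] {r : ℕ} (A B C D : Fin r → F) (h : Fin (2 * r) → Bool) : F :=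
  ∏ i : Fin r, bendw (A i) (B i) (C i) (D i)
        (h ⟨2*i.val+1, by have := i.isLt; omega⟩)
        (h ⟨2*i.val, by have := i.isLt; omega⟩)

/-- Bottom multiplicities. -/
def botm {r : ℕ} (lam : Fin r → ℕ) (c : ℕ) : ℕ := (Finset.univ.filter (fun i => lam i = c)).card

theorem BCState_ext' {r : ℕ} {lam : Fin r → ℕ} {L : ℕ} (s t : BCState r lam L)
    (hm : s.m = t.m) (hh : s.h = t.h) : s = t := by
  cases s; cases t; simp only at hm hh; subst hm; subst hh; rfl

theorem ZBC_eq {F : Type} [Field F] {r : ℕ} (lam : Fin r → ℕ) (L : ℕ)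
    (q : F) (x : Fin r → F) (A B C D : Fin r → F) :
    ZBC lam L q x A B C D =
      iterT (fun c => colW q (rowp x) (botm lam c)) (bendW A B C D) (L + 1) (fun _ => false) := by
  classical
  rw [← path_sum]
  let G := {h : Fin (L + 2) → Fin (2 * r) → Bool // h (Fin.last (L + 1)) = (fun _ => false) ∧
    ∀ c : Fin (L + 1), mm (h c.castSucc) (h c.succ) (botm lam c) (Fin.last (2 * r)) = 0}
  let e : G → BCState r lam L := fun h =>
    { m := fun s c => mm (h.1 c.castSucc) (h.1 c.succ) (botm lam c) s
      h := fun s c => h.1 c s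
      bottom := fun c => by simp [mm, botm]
      top := fun c => h.2.2 c
      right := fun s => by rw [h.2.1] }
  have einj : Function.Injective e := by
    intro h h' hh
    apply Subtype.ext
    funext c s
    exact congrFun (congrFun (congrArg BCState.h hh) s) c
  have hsupp : Function.support (stateWeight q x A B C D (lam := lam) (L := L)) ⊆ Set.range e := by
    intro st hst
    rw [Function.mem_support] at hst
    have h1 := left_ne_zero_of_mul hst
    rw [Finset.prod_ne_zero_iff] at h1
    have h2 : ∀ s c, st.m s.succ c =
        upm (st.h s c.castSucc) (st.h s c.succ) (st.m s.castSucc c) := by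
      intro s c
      have h3 := h1 s (Finset.mem_univ _)
      rw [Finset.prod_ne_zero_iff] at h3
      exact sixw_ne_zero (h3 c (Finset.mem_univ _))
    have h4 : ∀ s c, st.m s c = mm (fun s => st.h s c.castSucc) (fun s => st.h s c.succ)
        (botm lam c) s := by
      intro s c
      exact mm_unique _ _ _ (fun s => st.m s c) (st.bottom c) (fun s => h2 s c) s
    refine ⟨⟨fun c s => st.h s c, ?_, ?_⟩, ?_⟩
    · funext s; exact st.right s
    · intro c; rw [← h4, st.top]
    · apply BCState_ext'
      · funext s c
        exact (h4 s c).symm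
      · rfl
  have hstep : ZBC lam L q x A B C D = ∑ h : G, stateWeight q x A B C D (e h) := by
    unfold ZBC
    rw [← finsum_eq_sum_of_fintype, ← finsum_mem_range einj, finsum_mem_def,
      Set.indicator_eq_self.2 hsupp]
  rw [hstep]
  have hw : ∀ h : G, stateWeight q x A B C D (e h) =
      (∏ c : Fin (L + 1), colW q (rowp x) (botm lam c) (h.1 c.castSucc) (h.1 c.succ)) *
        bendW A B C D (h.1 0) := by
    intro h
    unfold stateWeight bendW
    rw [Finset.prod_comm]
    congr 1
    refine Finset.prod_congr rfl fun c _ => ?_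
    rw [colW, if_pos (h.2.2 c)]
  rw [Finset.sum_congr rfl fun h _ => hw h]
  rw [← Finset.sum_subtype (Finset.univ.filter fun h : Fin (L + 2) → Fin (2 * r) → Bool =>
      h (Fin.last (L + 1)) = (fun _ => false) ∧ ∀ c : Fin (L + 1),
        mm (h c.castSucc) (h c.succ) (botm lam c) (Fin.last (2 * r)) = 0) (by simp)
      (fun h => (∏ c : Fin (L + 1), colW q (rowp x) (botm lam c) (h c.castSucc) (h c.succ)) *
        bendW A B C D (h 0)), Finset.sum_filter]
  refine Finset.sum_congr rfl fun h _ => ?_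
  by_cases h1 : h (Fin.last (L + 1)) = (fun _ => false)
  · by_cases h2 : ∀ c : Fin (L + 1),
        mm (h c.castSucc) (h c.succ) (botm lam c) (Fin.last (2 * r)) = 0
    · rw [if_pos ⟨h1, h2⟩, if_pos h1]
    · rw [if_neg (fun h3 => h2 h3.2), if_pos h1]
      push Not at h2
      obtain ⟨c, hc⟩ := h2
      rw [Finset.prod_eq_zero (Finset.mem_univ c), zero_mul]
      rw [colW, if_neg hc]
  · rw [if_neg (fun h3 => h1 h3.1), if_neg h1]

/-! ### Explicit transfer matrices for four rows -/

theorem sum_cfg {F : Type} [Field F] (f : (Fin 4 → Bool) → F) :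
    ∑ h, f h = ∑ a : Bool, ∑ b : Bool, ∑ c : Bool, ∑ d : Bool, f ![a, b, c, d] := by
  let e : Bool × Bool × Bool × Bool ≃ (Fin 4 → Bool) :=
    { toFun := fun p => ![p.1, p.2.1, p.2.2.1, p.2.2.2]
      invFun := fun h => (h 0, h 1, h 2, h 3)
      left_inv := fun p => rfl
      right_inv := fun h => by funext i; fin_cases i <;> rfl }
  rw [← e.sum_comp]
  simp only [Fintype.sum_prod_type]
  rfl

theorem colW4 {F : Type} [Field F] (q : F) (z : Fin 4 → F) (b : ℕ)
    (l0 l1 l2 l3 r0 r1 r2 r3 : Bool) :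
    colW q z b ![l0, l1, l2, l3] ![r0, r1, r2, r3] =
      if upm l3 r3 (upm l2 r2 (upm l1 r1 (upm l0 r0 b))) = 0 then
        sixw q (z 0) l0 r0 (upm l0 r0 b) b *
        sixw q (z 1) l1 r1 (upm l1 r1 (upm l0 r0 b)) (upm l0 r0 b) *
        sixw q (z 2) l2 r2 (upm l2 r2 (upm l1 r1 (upm l0 r0 b))) (upm l1 r1 (upm l0 r0 b)) *
        sixw q (z 3) l3 r3 (upm l3 r3 (upm l2 r2 (upm l1 r1 (upm l0 r0 b))))
          (upm l2 r2 (upm l1 r1 (upm l0 r0 b)))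
      else 0 := by
  rw [colW, Fin.prod_univ_four]
  rfl

/-- The two-particle labels. -/
def cf12 : Fin 4 → Bool := ![true, true, false, false]
def cf13 : Fin 4 → Bool := ![true, false, true, false]
def cf14 : Fin 4 → Bool := ![true, false, false, true]
def cf23 : Fin 4 → Bool := ![false, true, true, false]
def cf24 : Fin 4 → Bool := ![false, true, false, true]
def cf34 : Fin 4 → Bool := ![false, false, true, true]
def cf1 : Fin 4 → Bool := ![true, false, false, false]
def cf2 : Fin 4 → Bool := ![false, true, false, false]
def cf3 : Fin 4 → Bool := ![false, false, true, false]
def cf4 : Fin 4 → Bool := ![false, false, false, true]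
def cf0 : Fin 4 → Bool := ![false, false, false, false]

/-- One transfer step. -/
def stepT {F : Type} [Field F] (q : F) (z : Fin 4 → F) (b : ℕ) (β : (Fin 4 → Bool) → F)
    (r : Fin 4 → Bool) : F := ∑ l, β l * colW q z b l r

/-- Two-particle part of a covector. -/
structure V6 (F : Type) where
  a12 : F
  a13 : F
  a14 : F
  a23 : F
  a24 : F
  a34 : F

/-- One-particle part of a covector. -/
structure V4 (F : Type) where
  a1 : F
  a2 : F
  a3 : F
  a4 : F

def pairs {F : Type} (β : (Fin 4 → Bool) → F) : V6 F :=
  ⟨β cf12, β cf13, β cf14, β cf23, β cf24, β cf34⟩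

def singles {F : Type} (β : (Fin 4 → Bool) → F) : V4 F := ⟨β cf1, β cf2, β cf3, β cf4⟩

/-- Empty column, two particles. -/
def T20 {F : Type} [Field F] (q z1 z2 z3 z4 : F) (v : V6 F) : V6 F where
  a34 := z3 * z4 * v.a34
  a24 := z2 * z4 * v.a24 + (1 - q) * z3 * z4 * v.a34
  a23 := z2 * z3 * v.a23 + (1 - q) * z2 * z4 * v.a24 + (1 - q) * z3 * z4 * v.a34
  a14 := z1 * z4 * v.a14 + (1 - q) * z2 * z4 * v.a24 + (1 - q) * z3 * z4 * v.a34
  a13 := z1 * z3 * v.a13 + (1 - q) * z1 * z4 * v.a14 + (1 - q) * z2 * z3 * v.a23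
    + (1 - q) ^ 2 * z2 * z4 * v.a24 + (1 - q) * z3 * z4 * v.a34
  a12 := z1 * z2 * v.a12 + (1 - q) * z1 * z3 * v.a13 + (1 - q) * z1 * z4 * v.a14
    + (1 - q) * z2 * z3 * v.a23 + (1 - q) * z2 * z4 * v.a24
    + (1 - q) * (1 - q ^ 2) * z3 * z4 * v.a34

/-- Empty column, one particle. -/
def T10 {F : Type} [Field F] (q z1 z2 z3 z4 : F) (v : V4 F) : V4 F where
  a4 := z4 * v.a4
  a3 := z3 * v.a3 + (1 - q) * z4 * v.a4
  a2 := z2 * v.a2 + (1 - q) * z3 * v.a3 + (1 - q) * z4 * v.a4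
  a1 := z1 * v.a1 + (1 - q) * z2 * v.a2 + (1 - q) * z3 * v.a3 + (1 - q) * z4 * v.a4

/-- Column with one particle entering, two particles to one. -/
def T21 {F : Type} [Field F] (q z1 z2 z3 z4 : F) (v : V6 F) : V4 F where
  a4 := z1 * z4 * v.a14 + z2 * z4 * v.a24 + z3 * z4 * v.a34
  a3 := z1 * z3 * v.a13 + z2 * z3 * v.a23 + (1 - q) * z1 * z4 * v.a14
    + (1 - q) * z2 * z4 * v.a24 + z3 * z4 * v.a34
  a2 := z1 * z2 * v.a12 + (1 - q) * z1 * z3 * v.a13 + (1 - q) * z1 * z4 * v.a14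
    + z2 * z3 * v.a23 + z2 * z4 * v.a24 + (1 - q ^ 2) * z3 * z4 * v.a34
  a1 := z1 * z2 * v.a12 + z1 * z3 * v.a13 + z1 * z4 * v.a14
    + (1 - q ^ 2) * z2 * z3 * v.a23 + (1 - q ^ 2) * z2 * z4 * v.a24
    + (1 - q ^ 2) * z3 * z4 * v.a34

/-- Column with one particle entering, one particle to none. -/
def T11 {F : Type} [Field F] (z1 z2 z3 z4 : F) (v : V4 F) : F :=
  z1 * v.a1 + z2 * v.a2 + z3 * v.a3 + z4 * v.a4

/-- Column with two particles entering. -/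
def T22 {F : Type} [Field F] (z1 z2 z3 z4 : F) (v : V6 F) : F :=
  z1 * z2 * v.a12 + z1 * z3 * v.a13 + z1 * z4 * v.a14
    + z2 * z3 * v.a23 + z2 * z4 * v.a24 + z3 * z4 * v.a34

theorem pairs_step {F : Type} [Field F] (q : F) (z : Fin 4 → F) (β : (Fin 4 → Bool) → F) :
    pairs (stepT q z 0 β) = T20 q (z 0) (z 1) (z 2) (z 3) (pairs β) := by
  simp only [pairs, T20, V6.mk.injEq, stepT, sum_cfg, Fintype.sum_bool, cf12, cf13, cf14, cf23, cf24, cf34,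
    colW4]
  simp [sixw, upm]
  refine ⟨?_, ?_, ?_, ?_, ?_, ?_⟩ <;> ring

theorem singles_step {F : Type} [Field F] (q : F) (z : Fin 4 → F) (β : (Fin 4 → Bool) → F) :
    singles (stepT q z 0 β) = T10 q (z 0) (z 1) (z 2) (z 3) (singles β) := by
  simp only [singles, T10, V4.mk.injEq, stepT, sum_cfg, Fintype.sum_bool, cf1, cf2, cf3, cf4,
    colW4]
  simp [sixw, upm]
  refine ⟨?_, ?_, ?_, ?_⟩ <;> ring

theorem singles_step1 {F : Type} [Field F] (q : F) (z : Fin 4 → F) (β : (Fin 4 → Bool) → F) :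
    singles (stepT q z 1 β) = T21 q (z 0) (z 1) (z 2) (z 3) (pairs β) := by
  simp only [singles, pairs, T21, V4.mk.injEq, stepT, sum_cfg, Fintype.sum_bool, cf1, cf2, cf3,
    cf4, cf12, cf13, cf14, cf23, cf24, cf34, colW4]
  simp [sixw, upm]
  refine ⟨?_, ?_, ?_, ?_⟩ <;> ring

theorem zero_step1 {F : Type} [Field F] (q : F) (z : Fin 4 → F) (β : (Fin 4 → Bool) → F) :
    stepT q z 1 β cf0 = T11 (z 0) (z 1) (z 2) (z 3) (singles β) := by
  simp only [singles, T11, stepT, sum_cfg, Fintype.sum_bool, cf1, cf2, cf3,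
    cf4, cf0, colW4]
  simp [sixw, upm]
  ring

theorem zero_step2 {F : Type} [Field F] (q : F) (z : Fin 4 → F) (β : (Fin 4 → Bool) → F) :
    stepT q z 2 β cf0 = T22 (z 0) (z 1) (z 2) (z 3) (pairs β) := by
  simp only [pairs, T22, stepT, sum_cfg, Fintype.sum_bool, cf12, cf13, cf14, cf23, cf24, cf34,
    cf0, colW4]
  simp [sixw, upm]
  ring

/-! ### Linear structure and eigencovectors -/

def ad6 {F : Type} [Field F] (v w : V6 F) : V6 F :=
  ⟨v.a12 + w.a12, v.a13 + w.a13, v.a14 + w.a14, v.a23 + w.a23, v.a24 + w.a24, v.a34 + w.a34⟩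

def sm6 {F : Type} [Field F] (c : F) (v : V6 F) : V6 F :=
  ⟨c * v.a12, c * v.a13, c * v.a14, c * v.a23, c * v.a24, c * v.a34⟩

def ad4 {F : Type} [Field F] (v w : V4 F) : V4 F :=
  ⟨v.a1 + w.a1, v.a2 + w.a2, v.a3 + w.a3, v.a4 + w.a4⟩

def sm4 {F : Type} [Field F] (c : F) (v : V4 F) : V4 F :=
  ⟨c * v.a1, c * v.a2, c * v.a3, c * v.a4⟩

/-- The amplitude of a two-particle covector, with particles entering in columns
`n` and `n + k`. -/
def Amp {F : Type} [Field F] (q z1 z2 z3 z4 : F) (n : ℕ) : ℕ → V6 F → F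
  | 0, v => T22 z1 z2 z3 z4 ((T20 q z1 z2 z3 z4)^[n] v)
  | k + 1, v => T11 z1 z2 z3 z4 ((T10 q z1 z2 z3 z4)^[k]
      (T21 q z1 z2 z3 z4 ((T20 q z1 z2 z3 z4)^[n] v)))

section
variable {F : Type} [Field F] (q z1 z2 z3 z4 : F)

theorem T20_ad (v w : V6 F) : T20 q z1 z2 z3 z4 (ad6 v w) =
    ad6 (T20 q z1 z2 z3 z4 v) (T20 q z1 z2 z3 z4 w) := by
  simp only [T20, ad6, V6.mk.injEq]
  refine ⟨?_, ?_, ?_, ?_, ?_, ?_⟩ <;> ring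

theorem T20_sm (c : F) (v : V6 F) : T20 q z1 z2 z3 z4 (sm6 c v) =
    sm6 c (T20 q z1 z2 z3 z4 v) := by
  simp only [T20, sm6, V6.mk.injEq]
  refine ⟨?_, ?_, ?_, ?_, ?_, ?_⟩ <;> ring

theorem T10_ad (v w : V4 F) : T10 q z1 z2 z3 z4 (ad4 v w) =
    ad4 (T10 q z1 z2 z3 z4 v) (T10 q z1 z2 z3 z4 w) := by
  simp only [T10, ad4, V4.mk.injEq]
  refine ⟨?_, ?_, ?_, ?_⟩ <;> ring

theorem T10_sm (c : F) (v : V4 F) : T10 q z1 z2 z3 z4 (sm4 c v) =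
    sm4 c (T10 q z1 z2 z3 z4 v) := by
  simp only [T10, sm4, V4.mk.injEq]
  refine ⟨?_, ?_, ?_, ?_⟩ <;> ring

theorem T21_ad (v w : V6 F) : T21 q z1 z2 z3 z4 (ad6 v w) =
    ad4 (T21 q z1 z2 z3 z4 v) (T21 q z1 z2 z3 z4 w) := by
  simp only [T21, ad6, ad4, V4.mk.injEq]
  refine ⟨?_, ?_, ?_, ?_⟩ <;> ring

theorem T21_sm (c : F) (v : V6 F) : T21 q z1 z2 z3 z4 (sm6 c v) =
    sm4 c (T21 q z1 z2 z3 z4 v) := by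
  simp only [T21, sm6, sm4, V4.mk.injEq]
  refine ⟨?_, ?_, ?_, ?_⟩ <;> ring

theorem T11_ad (v w : V4 F) : T11 z1 z2 z3 z4 (ad4 v w) =
    T11 z1 z2 z3 z4 v + T11 z1 z2 z3 z4 w := by
  simp only [T11, ad4]; ring

theorem T11_sm (c : F) (v : V4 F) : T11 z1 z2 z3 z4 (sm4 c v) = c * T11 z1 z2 z3 z4 v := by
  simp only [T11, sm4]; ring

theorem T22_ad (v w : V6 F) : T22 z1 z2 z3 z4 (ad6 v w) =
    T22 z1 z2 z3 z4 v + T22 z1 z2 z3 z4 w := by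
  simp only [T22, ad6]; ring

theorem T22_sm (c : F) (v : V6 F) : T22 z1 z2 z3 z4 (sm6 c v) = c * T22 z1 z2 z3 z4 v := by
  simp only [T22, sm6]; ring

theorem iter_ad6 (n : ℕ) (v w : V6 F) : (T20 q z1 z2 z3 z4)^[n] (ad6 v w) =
    ad6 ((T20 q z1 z2 z3 z4)^[n] v) ((T20 q z1 z2 z3 z4)^[n] w) := by
  induction n with
  | zero => rfl
  | succ n ih => simp only [Function.iterate_succ_apply', ih, T20_ad]

theorem iter_sm6 (n : ℕ) (c : F) (v : V6 F) : (T20 q z1 z2 z3 z4)^[n] (sm6 c v) =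
    sm6 c ((T20 q z1 z2 z3 z4)^[n] v) := by
  induction n with
  | zero => rfl
  | succ n ih => simp only [Function.iterate_succ_apply', ih, T20_sm]

theorem iter_ad4 (n : ℕ) (v w : V4 F) : (T10 q z1 z2 z3 z4)^[n] (ad4 v w) =
    ad4 ((T10 q z1 z2 z3 z4)^[n] v) ((T10 q z1 z2 z3 z4)^[n] w) := by
  induction n with
  | zero => rfl
  | succ n ih => simp only [Function.iterate_succ_apply', ih, T10_ad]

theorem iter_sm4 (n : ℕ) (c : F) (v : V4 F) : (T10 q z1 z2 z3 z4)^[n] (sm4 c v) =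
    sm4 c ((T10 q z1 z2 z3 z4)^[n] v) := by
  induction n with
  | zero => rfl
  | succ n ih => simp only [Function.iterate_succ_apply', ih, T10_sm]

theorem iter_eig6 (e : F) (v : V6 F) (h : T20 q z1 z2 z3 z4 v = sm6 e v) (n : ℕ) :
    (T20 q z1 z2 z3 z4)^[n] v = sm6 (e ^ n) v := by
  induction n with
  | zero => simp [sm6]
  | succ n ih =>
    rw [Function.iterate_succ_apply', ih, T20_sm, h]
    simp only [sm6, V6.mk.injEq]
    refine ⟨?_, ?_, ?_, ?_, ?_, ?_⟩ <;> ring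

theorem iter_eig4 (e : F) (v : V4 F) (h : T10 q z1 z2 z3 z4 v = sm4 e v) (n : ℕ) :
    (T10 q z1 z2 z3 z4)^[n] v = sm4 (e ^ n) v := by
  induction n with
  | zero => simp [sm4]
  | succ n ih =>
    rw [Function.iterate_succ_apply', ih, T10_sm, h]
    simp only [sm4, V4.mk.injEq]
    refine ⟨?_, ?_, ?_, ?_⟩ <;> ring

theorem Amp_ad (n k : ℕ) (v w : V6 F) : Amp q z1 z2 z3 z4 n k (ad6 v w) =
    Amp q z1 z2 z3 z4 n k v + Amp q z1 z2 z3 z4 n k w := by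
  cases k with
  | zero => simp only [Amp, iter_ad6, T22_ad]
  | succ k => simp only [Amp, iter_ad6, T21_ad, iter_ad4, T11_ad]

theorem Amp_sm (n k : ℕ) (c : F) (v : V6 F) : Amp q z1 z2 z3 z4 n k (sm6 c v) =
    c * Amp q z1 z2 z3 z4 n k v := by
  cases k with
  | zero => simp only [Amp, iter_sm6, T22_sm]
  | succ k => simp only [Amp, iter_sm6, T21_sm, iter_sm4, T11_sm]

/-- Amplitude of an eigencovector. -/
theorem Amp_eig (n k : ℕ) (ξ : V6 F) (ηa ηb : V4 F) (za zb ya yb ha hb N c : F)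
    (hξ : T20 q z1 z2 z3 z4 ξ = sm6 (za * zb) ξ)
    (hη : T21 q z1 z2 z3 z4 ξ = ad4 (sm4 ya ηa) (sm4 yb ηb))
    (hηa : T10 q z1 z2 z3 z4 ηa = sm4 za ηa) (hηb : T10 q z1 z2 z3 z4 ηb = sm4 zb ηb)
    (hta : T11 z1 z2 z3 z4 ηa = ha) (htb : T11 z1 z2 z3 z4 ηb = hb)
    (hya : ya * ha = N * za * ((za - q * zb) / (za - zb)))
    (hyb : yb * hb = N * zb * ((zb - q * za) / (zb - za)))
    (hab : za ≠ zb) (hc : c = if k = 0 then 1 + q else 1) (hc0 : c ≠ 0)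
    (h22 : T22 z1 z2 z3 z4 ξ = N) :
    Amp q z1 z2 z3 z4 n k ξ = N / c * (za * zb) ^ n *
      (za ^ k * ((za - q * zb) / (za - zb)) + zb ^ k * ((zb - q * za) / (zb - za))) := by
  cases k with
  | zero =>
    simp only [Amp]
    rw [iter_eig6 _ _ _ _ _ _ _ hξ, T22_sm, h22]
    rw [if_pos rfl] at hc
    have h1 : za - zb ≠ 0 := sub_ne_zero.2 hab
    have h2 : zb - za ≠ 0 := sub_ne_zero.2 hab.symm
    have h3 : (za - q * zb) / (za - zb) + (zb - q * za) / (zb - za) = c := by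
      rw [hc, ← neg_sub za zb]
      field_simp
      ring
    rw [pow_zero, pow_zero, one_mul, one_mul, h3]
    field_simp
  | succ k =>
    simp only [Amp]
    rw [if_neg (Nat.succ_ne_zero k)] at hc
    rw [iter_eig6 _ _ _ _ _ _ _ hξ, T21_sm, hη, iter_sm4, iter_ad4, iter_sm4, iter_sm4,
      iter_eig4 _ _ _ _ _ _ _ hηa, iter_eig4 _ _ _ _ _ _ _ hηb, T11_sm, T11_ad, T11_sm, T11_sm,
      T11_sm, T11_sm, hta, htb, hc]
    linear_combination (za * zb) ^ n * za ^ k * hya + (za * zb) ^ n * zb ^ k * hyb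

end

/-- Elementary factors. -/
def Rf {F : Type} [Field F] (q a c : F) : F := (a - q * c) / (a - c)
def Uf {F : Type} [Field F] (q a c : F) : F := (1 - q) * a / (a - c)

section
variable {F : Type} [Field F] (q z1 z2 z3 z4 : F)

def eta1 : V4 F := ⟨1, 0, 0, 0⟩
def eta2 : V4 F := ⟨Uf q z2 z1, 1, 0, 0⟩
def eta3 : V4 F := ⟨Uf q z3 z1 * Rf q z3 z2, Uf q z3 z2, 1, 0⟩
def eta4 : V4 F := ⟨Uf q z4 z1 * Rf q z4 z2 * Rf q z4 z3, Uf q z4 z2 * Rf q z4 z3, Uf q z4 z3, 1⟩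

def xi12 : V6 F := ⟨1, 0, 0, 0, 0, 0⟩
def xi13 : V6 F := ⟨Uf q z3 z2, 1, 0, 0, 0, 0⟩
def xi14 : V6 F := ⟨Uf q z4 z2 * Rf q z4 z3, Uf q z4 z3, 1, 0, 0, 0⟩
def xi23 : V6 F := ⟨Uf q z3 z1 * Rf q z2 z1, Uf q z2 z1, 0, 1, 0, 0⟩
def xi24 : V6 F := ⟨Uf q z4 z1 * Rf q z2 z1 * Rf q z4 z3, Uf q z2 z1 * Uf q z4 z3, Uf q z2 z1,
  Uf q z4 z3, 1, 0⟩
def xi34 : V6 F where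
  a12 := (1 - q) ^ 2 * z3 * z4 * ((1 + q) * z3 * z4 - q * (z1 + z2) * (z3 + z4)
    + q * (1 + q) * z1 * z2) / ((z3 - z1) * (z3 - z2) * (z4 - z1) * (z4 - z2))
  a13 := (1 - q) * (z1 * z4 * (Uf q z3 z1 * Rf q z3 z2) + z2 * z3 * (Uf q z4 z2 * Rf q z3 z2)
    + (1 - q) * z2 * z4 * Uf q z3 z2 + z3 * z4) / (z3 * (z4 - z1))
  a14 := Uf q z3 z1 * Rf q z3 z2
  a23 := Uf q z4 z2 * Rf q z3 z2
  a24 := Uf q z3 z2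
  a34 := 1

/-- Genericity of the parameters. -/
structure Gen : Prop where
  h1 : z1 ≠ 0
  h2 : z2 ≠ 0
  h3 : z3 ≠ 0
  h4 : z4 ≠ 0
  d21 : z2 - z1 ≠ 0
  d31 : z3 - z1 ≠ 0
  d41 : z4 - z1 ≠ 0
  d32 : z3 - z2 ≠ 0
  d42 : z4 - z2 ≠ 0
  d43 : z4 - z3 ≠ 0

variable {z1 z2 z3 z4}

theorem eig_eta1 : T10 q z1 z2 z3 z4 eta1 = sm4 z1 eta1 := by
  simp [T10, sm4, eta1]

theorem eig_eta2 (g : Gen z1 z2 z3 z4) :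
    T10 q z1 z2 z3 z4 (eta2 q z1 z2) = sm4 z2 (eta2 q z1 z2) := by
  obtain ⟨h1, h2, h3, h4, d21, d31, d41, d32, d42, d43⟩ := g
  simp only [T10, sm4, eta2, V4.mk.injEq, Uf]
  refine ⟨?_, ?_, ?_, ?_⟩ <;> first | trivial | ring1 | (field_simp; done) | (field_simp; ring1)

theorem eig_eta3 (g : Gen z1 z2 z3 z4) :
    T10 q z1 z2 z3 z4 (eta3 q z1 z2 z3) = sm4 z3 (eta3 q z1 z2 z3) := by
  obtain ⟨h1, h2, h3, h4, d21, d31, d41, d32, d42, d43⟩ := g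
  simp only [T10, sm4, eta3, V4.mk.injEq, Uf, Rf]
  refine ⟨?_, ?_, ?_, ?_⟩ <;> first | trivial | ring1 | (field_simp; done) | (field_simp; ring1)

theorem eig_eta4 (g : Gen z1 z2 z3 z4) :
    T10 q z1 z2 z3 z4 (eta4 q z1 z2 z3 z4) = sm4 z4 (eta4 q z1 z2 z3 z4) := by
  obtain ⟨h1, h2, h3, h4, d21, d31, d41, d32, d42, d43⟩ := g
  simp only [T10, sm4, eta4, V4.mk.injEq, Uf, Rf]
  refine ⟨?_, ?_, ?_, ?_⟩ <;> first | trivial | ring1 | (field_simp; done) | (field_simp; ring1)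

theorem t11_eta1 : T11 z1 z2 z3 z4 eta1 = z1 := by
  simp [T11, eta1]

theorem t11_eta2 (g : Gen z1 z2 z3 z4) :
    T11 z1 z2 z3 z4 (eta2 q z1 z2) = z2 * Rf q z2 z1 := by
  obtain ⟨h1, h2, h3, h4, d21, d31, d41, d32, d42, d43⟩ := g
  simp only [T11, eta2, Uf, Rf]
  field_simp
  ring

theorem t11_eta3 (g : Gen z1 z2 z3 z4) :
    T11 z1 z2 z3 z4 (eta3 q z1 z2 z3) = z3 * Rf q z3 z1 * Rf q z3 z2 := by
  obtain ⟨h1, h2, h3, h4, d21, d31, d41, d32, d42, d43⟩ := g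
  simp only [T11, eta3, Uf, Rf]
  field_simp
  ring

theorem t11_eta4 (g : Gen z1 z2 z3 z4) :
    T11 z1 z2 z3 z4 (eta4 q z1 z2 z3 z4) = z4 * Rf q z4 z1 * Rf q z4 z2 * Rf q z4 z3 := by
  obtain ⟨h1, h2, h3, h4, d21, d31, d41, d32, d42, d43⟩ := g
  simp only [T11, eta4, Uf, Rf]
  field_simp
  ring

end

section
variable {F : Type} [Field F] (q : F) {z1 z2 z3 z4 : F}

theorem eig_xi12 (g : Gen z1 z2 z3 z4) :
    T20 q z1 z2 z3 z4 xi12 = sm6 (z1 * z2) xi12 := by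
  obtain ⟨h1, h2, h3, h4, d21, d31, d41, d32, d42, d43⟩ := g
  simp only [T20, sm6, xi12, V6.mk.injEq, Uf, Rf]
  refine ⟨?_, ?_, ?_, ?_, ?_, ?_⟩ <;> first | trivial | ring1 | (field_simp; done) | (field_simp; ring1)

theorem t21_xi12 (g : Gen z1 z2 z3 z4) :
    T21 q z1 z2 z3 z4 xi12 = ad4 (sm4 (z1 * z2 * Rf q z1 z2) eta1)
      (sm4 (z1 * z2) (eta2 q z1 z2)) := by
  obtain ⟨h1, h2, h3, h4, d21, d31, d41, d32, d42, d43⟩ := g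
  simp only [T21, sm4, ad4, xi12, eta1, eta2, V4.mk.injEq, Uf, Rf, ← neg_sub z2 z1]
  refine ⟨?_, ?_, ?_, ?_⟩ <;> first | trivial | ring1 | (field_simp; done) | (field_simp; ring1)

theorem t22_xi12 (g : Gen z1 z2 z3 z4) :
    T22 z1 z2 z3 z4 xi12 = z1 * z2 := by
  obtain ⟨h1, h2, h3, h4, d21, d31, d41, d32, d42, d43⟩ := g
  simp only [T22, xi12, Uf, Rf]
  first | trivial | ring1 | (field_simp; done) | (field_simp; ring1)

theorem Amp_xi12 (g : Gen z1 z2 z3 z4) (n k : ℕ) (c : F)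
    (hc : c = if k = 0 then 1 + q else 1) (hc0 : c ≠ 0) :
    Amp q z1 z2 z3 z4 n k xi12 = z1 * z2 / c * (z1 * z2) ^ n *
      (z1 ^ k * Rf q z1 z2 + z2 ^ k * Rf q z2 z1) := by
  refine Amp_eig q z1 z2 z3 z4 n k _ _ _ _ _ _ _ _ _ _ c (eig_xi12 q g) (t21_xi12 q g)
    (eig_eta1 q) (eig_eta2 q g) t11_eta1 (t11_eta2 q g) ?_ ?_ ?_ hc hc0
    (t22_xi12 g)
  · simp only [Rf]; ring
  · simp only [Rf]; ring
  · exact fun h => g.d21 (sub_eq_zero.2 h.symm)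

theorem eig_xi13 (g : Gen z1 z2 z3 z4) :
    T20 q z1 z2 z3 z4 (xi13 q z2 z3) = sm6 (z1 * z3) (xi13 q z2 z3) := by
  obtain ⟨h1, h2, h3, h4, d21, d31, d41, d32, d42, d43⟩ := g
  simp only [T20, sm6, xi13, V6.mk.injEq, Uf, Rf]
  refine ⟨?_, ?_, ?_, ?_, ?_, ?_⟩ <;> first | trivial | ring1 | (field_simp; done) | (field_simp; ring1)

theorem t21_xi13 (g : Gen z1 z2 z3 z4) :
    T21 q z1 z2 z3 z4 (xi13 q z2 z3) = ad4 (sm4 (z1 * z3 * Rf q z3 z2 * Rf q z1 z3) eta1)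
      (sm4 (z1 * z3) (eta3 q z1 z2 z3)) := by
  obtain ⟨h1, h2, h3, h4, d21, d31, d41, d32, d42, d43⟩ := g
  simp only [T21, sm4, ad4, xi13, eta1, eta3, V4.mk.injEq, Uf, Rf, ← neg_sub z3 z1]
  refine ⟨?_, ?_, ?_, ?_⟩ <;> first | trivial | ring1 | (field_simp; done) | (field_simp; ring1)

theorem t22_xi13 (g : Gen z1 z2 z3 z4) :
    T22 z1 z2 z3 z4 (xi13 q z2 z3) = z1 * z3 * Rf q z3 z2 := by
  obtain ⟨h1, h2, h3, h4, d21, d31, d41, d32, d42, d43⟩ := g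
  simp only [T22, xi13, Uf, Rf]
  first | trivial | ring1 | (field_simp; done) | (field_simp; ring1)

theorem Amp_xi13 (g : Gen z1 z2 z3 z4) (n k : ℕ) (c : F)
    (hc : c = if k = 0 then 1 + q else 1) (hc0 : c ≠ 0) :
    Amp q z1 z2 z3 z4 n k (xi13 q z2 z3) = z1 * z3 * Rf q z3 z2 / c * (z1 * z3) ^ n *
      (z1 ^ k * Rf q z1 z3 + z3 ^ k * Rf q z3 z1) := by
  refine Amp_eig q z1 z2 z3 z4 n k _ _ _ _ _ _ _ _ _ _ c (eig_xi13 q g) (t21_xi13 q g)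
    (eig_eta1 q) (eig_eta3 q g) t11_eta1 (t11_eta3 q g) ?_ ?_ ?_ hc hc0
    (t22_xi13 q g)
  · simp only [Rf]; ring
  · simp only [Rf]; ring
  · exact fun h => g.d31 (sub_eq_zero.2 h.symm)

theorem eig_xi14 (g : Gen z1 z2 z3 z4) :
    T20 q z1 z2 z3 z4 (xi14 q z2 z3 z4) = sm6 (z1 * z4) (xi14 q z2 z3 z4) := by
  obtain ⟨h1, h2, h3, h4, d21, d31, d41, d32, d42, d43⟩ := g
  simp only [T20, sm6, xi14, V6.mk.injEq, Uf, Rf]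
  refine ⟨?_, ?_, ?_, ?_, ?_, ?_⟩ <;> first | trivial | ring1 | (field_simp; done) | (field_simp; ring1)

theorem t21_xi14 (g : Gen z1 z2 z3 z4) :
    T21 q z1 z2 z3 z4 (xi14 q z2 z3 z4) = ad4 (sm4 (z1 * z4 * Rf q z4 z2 * Rf q z4 z3 * Rf q z1 z4) eta1)
      (sm4 (z1 * z4) (eta4 q z1 z2 z3 z4)) := by
  obtain ⟨h1, h2, h3, h4, d21, d31, d41, d32, d42, d43⟩ := g
  simp only [T21, sm4, ad4, xi14, eta1, eta4, V4.mk.injEq, Uf, Rf, ← neg_sub z4 z1]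
  refine ⟨?_, ?_, ?_, ?_⟩ <;> first | trivial | ring1 | (field_simp; done) | (field_simp; ring1)

theorem t22_xi14 (g : Gen z1 z2 z3 z4) :
    T22 z1 z2 z3 z4 (xi14 q z2 z3 z4) = z1 * z4 * Rf q z4 z2 * Rf q z4 z3 := by
  obtain ⟨h1, h2, h3, h4, d21, d31, d41, d32, d42, d43⟩ := g
  simp only [T22, xi14, Uf, Rf]
  first | trivial | ring1 | (field_simp; done) | (field_simp; ring1)

theorem Amp_xi14 (g : Gen z1 z2 z3 z4) (n k : ℕ) (c : F)
    (hc : c = if k = 0 then 1 + q else 1) (hc0 : c ≠ 0) :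
    Amp q z1 z2 z3 z4 n k (xi14 q z2 z3 z4) = z1 * z4 * Rf q z4 z2 * Rf q z4 z3 / c * (z1 * z4) ^ n *
      (z1 ^ k * Rf q z1 z4 + z4 ^ k * Rf q z4 z1) := by
  refine Amp_eig q z1 z2 z3 z4 n k _ _ _ _ _ _ _ _ _ _ c (eig_xi14 q g) (t21_xi14 q g)
    (eig_eta1 q) (eig_eta4 q g) t11_eta1 (t11_eta4 q g) ?_ ?_ ?_ hc hc0
    (t22_xi14 q g)
  · simp only [Rf]; ring
  · simp only [Rf]; ring
  · exact fun h => g.d41 (sub_eq_zero.2 h.symm)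

theorem eig_xi23 (g : Gen z1 z2 z3 z4) :
    T20 q z1 z2 z3 z4 (xi23 q z1 z2 z3) = sm6 (z2 * z3) (xi23 q z1 z2 z3) := by
  obtain ⟨h1, h2, h3, h4, d21, d31, d41, d32, d42, d43⟩ := g
  simp only [T20, sm6, xi23, V6.mk.injEq, Uf, Rf]
  refine ⟨?_, ?_, ?_, ?_, ?_, ?_⟩ <;> first | trivial | ring1 | (field_simp; done) | (field_simp; ring1)

theorem t21_xi23 (g : Gen z1 z2 z3 z4) :
    T21 q z1 z2 z3 z4 (xi23 q z1 z2 z3) = ad4 (sm4 (z2 * z3 * Rf q z3 z1 * Rf q z2 z3) (eta2 q z1 z2))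
      (sm4 (z2 * z3 * Rf q z2 z1) (eta3 q z1 z2 z3)) := by
  obtain ⟨h1, h2, h3, h4, d21, d31, d41, d32, d42, d43⟩ := g
  simp only [T21, sm4, ad4, xi23, eta2, eta3, V4.mk.injEq, Uf, Rf, ← neg_sub z3 z2]
  refine ⟨?_, ?_, ?_, ?_⟩ <;> first | trivial | ring1 | (field_simp; done) | (field_simp; ring1)

theorem t22_xi23 (g : Gen z1 z2 z3 z4) :
    T22 z1 z2 z3 z4 (xi23 q z1 z2 z3) = z2 * z3 * Rf q z2 z1 * Rf q z3 z1 := by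
  obtain ⟨h1, h2, h3, h4, d21, d31, d41, d32, d42, d43⟩ := g
  simp only [T22, xi23, Uf, Rf]
  first | trivial | ring1 | (field_simp; done) | (field_simp; ring1)

theorem Amp_xi23 (g : Gen z1 z2 z3 z4) (n k : ℕ) (c : F)
    (hc : c = if k = 0 then 1 + q else 1) (hc0 : c ≠ 0) :
    Amp q z1 z2 z3 z4 n k (xi23 q z1 z2 z3) = z2 * z3 * Rf q z2 z1 * Rf q z3 z1 / c * (z2 * z3) ^ n *
      (z2 ^ k * Rf q z2 z3 + z3 ^ k * Rf q z3 z2) := by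
  refine Amp_eig q z1 z2 z3 z4 n k _ _ _ _ _ _ _ _ _ _ c (eig_xi23 q g) (t21_xi23 q g)
    (eig_eta2 q g) (eig_eta3 q g) (t11_eta2 q g) (t11_eta3 q g) ?_ ?_ ?_ hc hc0
    (t22_xi23 q g)
  · simp only [Rf]; ring
  · simp only [Rf]; ring
  · exact fun h => g.d32 (sub_eq_zero.2 h.symm)

theorem eig_xi24 (g : Gen z1 z2 z3 z4) :
    T20 q z1 z2 z3 z4 (xi24 q z1 z2 z3 z4) = sm6 (z2 * z4) (xi24 q z1 z2 z3 z4) := by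
  obtain ⟨h1, h2, h3, h4, d21, d31, d41, d32, d42, d43⟩ := g
  simp only [T20, sm6, xi24, V6.mk.injEq, Uf, Rf]
  refine ⟨?_, ?_, ?_, ?_, ?_, ?_⟩ <;> first | trivial | ring1 | (field_simp; done) | (field_simp; ring1)

theorem t21_xi24 (g : Gen z1 z2 z3 z4) :
    T21 q z1 z2 z3 z4 (xi24 q z1 z2 z3 z4) = ad4 (sm4 (z2 * z4 * Rf q z4 z1 * Rf q z4 z3 * Rf q z2 z4) (eta2 q z1 z2))
      (sm4 (z2 * z4 * Rf q z2 z1) (eta4 q z1 z2 z3 z4)) := by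
  obtain ⟨h1, h2, h3, h4, d21, d31, d41, d32, d42, d43⟩ := g
  simp only [T21, sm4, ad4, xi24, eta2, eta4, V4.mk.injEq, Uf, Rf, ← neg_sub z4 z2]
  refine ⟨?_, ?_, ?_, ?_⟩ <;> first | trivial | ring1 | (field_simp; done) | (field_simp; ring1)

theorem t22_xi24 (g : Gen z1 z2 z3 z4) :
    T22 z1 z2 z3 z4 (xi24 q z1 z2 z3 z4) = z2 * z4 * Rf q z2 z1 * Rf q z4 z1 * Rf q z4 z3 := by
  obtain ⟨h1, h2, h3, h4, d21, d31, d41, d32, d42, d43⟩ := g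
  simp only [T22, xi24, Uf, Rf]
  first | trivial | ring1 | (field_simp; done) | (field_simp; ring1)

theorem Amp_xi24 (g : Gen z1 z2 z3 z4) (n k : ℕ) (c : F)
    (hc : c = if k = 0 then 1 + q else 1) (hc0 : c ≠ 0) :
    Amp q z1 z2 z3 z4 n k (xi24 q z1 z2 z3 z4) = z2 * z4 * Rf q z2 z1 * Rf q z4 z1 * Rf q z4 z3 / c * (z2 * z4) ^ n *
      (z2 ^ k * Rf q z2 z4 + z4 ^ k * Rf q z4 z2) := by
  refine Amp_eig q z1 z2 z3 z4 n k _ _ _ _ _ _ _ _ _ _ c (eig_xi24 q g) (t21_xi24 q g)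
    (eig_eta2 q g) (eig_eta4 q g) (t11_eta2 q g) (t11_eta4 q g) ?_ ?_ ?_ hc hc0
    (t22_xi24 q g)
  · simp only [Rf]; ring
  · simp only [Rf]; ring
  · exact fun h => g.d42 (sub_eq_zero.2 h.symm)

theorem eig_xi34 (g : Gen z1 z2 z3 z4) :
    T20 q z1 z2 z3 z4 (xi34 q z1 z2 z3 z4) = sm6 (z3 * z4) (xi34 q z1 z2 z3 z4) := by
  obtain ⟨h1, h2, h3, h4, d21, d31, d41, d32, d42, d43⟩ := g
  simp only [T20, sm6, xi34, V6.mk.injEq, Uf, Rf]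
  refine ⟨?_, ?_, ?_, ?_, ?_, ?_⟩ <;> first | trivial | ring1 | (field_simp; done) | (field_simp; ring1)

theorem t21_xi34 (g : Gen z1 z2 z3 z4) :
    T21 q z1 z2 z3 z4 (xi34 q z1 z2 z3 z4) = ad4 (sm4 (z3 * z4 * Rf q z4 z1 * Rf q z4 z2 * Rf q z3 z4) (eta3 q z1 z2 z3))
      (sm4 (z3 * z4 * Rf q z3 z1 * Rf q z3 z2) (eta4 q z1 z2 z3 z4)) := by
  obtain ⟨h1, h2, h3, h4, d21, d31, d41, d32, d42, d43⟩ := g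
  simp only [T21, sm4, ad4, xi34, eta3, eta4, V4.mk.injEq, Uf, Rf, ← neg_sub z4 z3]
  refine ⟨?_, ?_, ?_, ?_⟩ <;> first | trivial | ring1 | (field_simp; done) | (field_simp; ring1)

theorem t22_xi34 (g : Gen z1 z2 z3 z4) :
    T22 z1 z2 z3 z4 (xi34 q z1 z2 z3 z4) = z3 * z4 * Rf q z3 z1 * Rf q z3 z2 * Rf q z4 z1 * Rf q z4 z2 := by
  obtain ⟨h1, h2, h3, h4, d21, d31, d41, d32, d42, d43⟩ := g
  simp only [T22, xi34, Uf, Rf]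
  first | trivial | ring1 | (field_simp; done) | (field_simp; ring1)

theorem Amp_xi34 (g : Gen z1 z2 z3 z4) (n k : ℕ) (c : F)
    (hc : c = if k = 0 then 1 + q else 1) (hc0 : c ≠ 0) :
    Amp q z1 z2 z3 z4 n k (xi34 q z1 z2 z3 z4) = z3 * z4 * Rf q z3 z1 * Rf q z3 z2 * Rf q z4 z1 * Rf q z4 z2 / c * (z3 * z4) ^ n *
      (z3 ^ k * Rf q z3 z4 + z4 ^ k * Rf q z4 z3) := by
  refine Amp_eig q z1 z2 z3 z4 n k _ _ _ _ _ _ _ _ _ _ c (eig_xi34 q g) (t21_xi34 q g)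
    (eig_eta3 q g) (eig_eta4 q g) (t11_eta3 q g) (t11_eta4 q g) ?_ ?_ ?_ hc hc0
    (t22_xi34 q g)
  · simp only [Rf]; ring
  · simp only [Rf]; ring
  · exact fun h => g.d43 (sub_eq_zero.2 h.symm)

end

/-! ### The partition function as an amplitude -/

theorem botm2 (m n c : ℕ) :
    botm ![m, n] c = (if m = c then 1 else 0) + (if n = c then 1 else 0) := by
  unfold botm
  rw [Finset.card_filter, Fin.sum_univ_two]
  rfl

theorem iterT_succ' {F : Type} [Field F] (q : F) (z : Fin 4 → F) (b : ℕ → ℕ)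
    (β : (Fin 4 → Bool) → F) (n : ℕ) :
    iterT (fun c => colW q z (b c)) β (n + 1) =
      stepT q z (b n) (iterT (fun c => colW q z (b c)) β n) := rfl

theorem iter_pairs {F : Type} [Field F] (q : F) (z : Fin 4 → F) (b : ℕ → ℕ)
    (β : (Fin 4 → Bool) → F) (n : ℕ) (hb : ∀ c < n, b c = 0) :
    pairs (iterT (fun c => colW q z (b c)) β n) =
      (T20 q (z 0) (z 1) (z 2) (z 3))^[n] (pairs β) := by
  induction n with
  | zero => rfl
  | succ n ih =>
    rw [iterT_succ', hb n (Nat.lt_succ_self n), pairs_step,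
      ih (fun c hc => hb c (Nat.lt_succ_of_lt hc)), Function.iterate_succ_apply']

theorem iter_singles {F : Type} [Field F] (q : F) (z : Fin 4 → F) (b : ℕ → ℕ)
    (β : (Fin 4 → Bool) → F) (n k : ℕ) (hb : ∀ c < n, b c = 0) (hn : b n = 1)
    (hk : ∀ c, n < c → c < n + k + 1 → b c = 0) :
    singles (iterT (fun c => colW q z (b c)) β (n + k + 1)) =
      (T10 q (z 0) (z 1) (z 2) (z 3))^[k] (T21 q (z 0) (z 1) (z 2) (z 3)
        ((T20 q (z 0) (z 1) (z 2) (z 3))^[n] (pairs β))) := by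
  induction k with
  | zero =>
    rw [Nat.add_zero, iterT_succ', hn, singles_step1, iter_pairs q z b β n hb]
    rfl
  | succ k ih =>
    rw [show n + (k + 1) + 1 = (n + k + 1) + 1 by ring, iterT_succ',
      hk (n + k + 1) (by omega) (by omega), singles_step,
      ih (fun c h1 h2 => hk c h1 (by omega)), Function.iterate_succ_apply']

theorem iter_Amp {F : Type} [Field F] (q : F) (z : Fin 4 → F) (n k : ℕ)
    (β : (Fin 4 → Bool) → F) :
    iterT (fun c => colW q z (botm ![n + k, n] c)) β (n + k + 1) (fun _ => false) =
      Amp q (z 0) (z 1) (z 2) (z 3) n k (pairs β) := by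
  have hcf : (fun _ => false : Fin 4 → Bool) = cf0 := by
    funext i; fin_cases i <;> rfl
  rw [hcf]
  cases k with
  | zero =>
    rw [iterT_succ' q z (botm ![n + 0, n])]
    rw [show botm ![n + 0, n] n = 2 by rw [botm2]; simp]
    rw [zero_step2, iter_pairs q z (botm ![n + 0, n])]
    · rfl
    · intro c hc
      rw [botm2, if_neg (by omega), if_neg (by omega)]
  | succ k =>
    rw [iterT_succ' q z (botm ![n + (k + 1), n])]
    rw [show botm ![n + (k + 1), n] (n + (k + 1)) = 1 by rw [botm2]; simp]
    rw [zero_step1, ← Nat.add_assoc, iter_singles q z (botm ![n + k + 1, n])]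
    · rfl
    · intro c hc
      rw [botm2, if_neg (by omega), if_neg (by omega)]
    · rw [botm2, if_neg (by omega), if_pos rfl]
    · intro c h1 h2
      rw [botm2, if_neg (by omega), if_neg (by omega)]

theorem ZBC_Amp {F : Type} [Field F] (q : F) (x : Fin 2 → F) (n k : ℕ) (A B C D : Fin 2 → F) :
    ZBC ![n + k, n] (n + k) q x A B C D =
      Amp q (x 0)⁻¹ (x 0) (x 1)⁻¹ (x 1) n k
        ⟨D 0 * A 1, B 0 * B 1, B 0 * C 1, C 0 * B 1, C 0 * C 1, A 0 * D 1⟩ := by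
  rw [ZBC_eq]
  refine (iter_Amp q (rowp x) n k (bendW A B C D)).trans ?_
  have h : pairs (bendW A B C D) =
      ⟨D 0 * A 1, B 0 * B 1, B 0 * C 1, C 0 * B 1, C 0 * C 1, A 0 * D 1⟩ := by
    simp only [pairs, bendW, Fin.prod_univ_two]
    rfl
  rw [h]
  rfl

/-! ### Specialization to the type B/C parameters -/

section
variable {F : Type} [Field F]

/-- Genericity of two parameters. -/
structure Gen2 (a b : F) : Prop where
  ha : a ≠ 0
  hb : b ≠ 0
  hab : a - b ≠ 0
  hm : a * b - 1 ≠ 0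
  ha2 : a ^ 2 - 1 ≠ 0
  hb2 : b ^ 2 - 1 ≠ 0

theorem sub_inv_form {a : F} (h : a ≠ 0) : a - a⁻¹ = (a ^ 2 - 1) / a := by field_simp

theorem Gen2.gen {a b : F} (g : Gen2 a b) : Gen a⁻¹ a b⁻¹ b := by
  obtain ⟨ha, hb, hab, hm, ha2, hb2⟩ := g
  refine ⟨inv_ne_zero ha, ha, inv_ne_zero hb, hb, ?_, ?_, ?_, ?_, ?_, ?_⟩
  · rw [sub_inv_form ha]; exact div_ne_zero ha2 ha
  · rw [show b⁻¹ - a⁻¹ = (a - b) / (a * b) by field_simp]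
    exact div_ne_zero hab (mul_ne_zero ha hb)
  · rw [show b - a⁻¹ = (a * b - 1) / a by field_simp]
    exact div_ne_zero hm ha
  · rw [show b⁻¹ - a = -(a * b - 1) / b by field_simp; ring]
    exact div_ne_zero (neg_ne_zero.2 hm) hb
  · rw [← neg_sub]; exact neg_ne_zero.2 hab
  · rw [sub_inv_form hb]; exact div_ne_zero hb2 hb

section
variable (q : F) {a b : F}

theorem U21 (g : Gen2 a b) : Uf q a a⁻¹ = (1 - q) * a ^ 2 / (a ^ 2 - 1) := by
  obtain ⟨ha, hb, hab, hm, ha2, hb2⟩ := g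
  rw [Uf, sub_inv_form ha]; field_simp
theorem R21 (g : Gen2 a b) : Rf q a a⁻¹ = (a ^ 2 - q) / (a ^ 2 - 1) := by
  obtain ⟨ha, hb, hab, hm, ha2, hb2⟩ := g
  rw [Rf, sub_inv_form ha]; field_simp
theorem U43 (g : Gen2 a b) : Uf q b b⁻¹ = (1 - q) * b ^ 2 / (b ^ 2 - 1) := by
  obtain ⟨ha, hb, hab, hm, ha2, hb2⟩ := g
  rw [Uf, sub_inv_form hb]; field_simp
theorem R43 (g : Gen2 a b) : Rf q b b⁻¹ = (b ^ 2 - q) / (b ^ 2 - 1) := by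
  obtain ⟨ha, hb, hab, hm, ha2, hb2⟩ := g
  rw [Rf, sub_inv_form hb]; field_simp
theorem U31 (g : Gen2 a b) : Uf q b⁻¹ a⁻¹ = (1 - q) * a / (a - b) := by
  obtain ⟨ha, hb, hab, hm, ha2, hb2⟩ := g
  rw [Uf, show b⁻¹ - a⁻¹ = (a - b) / (a * b) by field_simp]; field_simp
theorem R31 (g : Gen2 a b) : Rf q b⁻¹ a⁻¹ = (a - q * b) / (a - b) := by
  obtain ⟨ha, hb, hab, hm, ha2, hb2⟩ := g
  rw [Rf, show b⁻¹ - a⁻¹ = (a - b) / (a * b) by field_simp]; field_simp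
theorem U41 (g : Gen2 a b) : Uf q b a⁻¹ = (1 - q) * (a * b) / (a * b - 1) := by
  obtain ⟨ha, hb, hab, hm, ha2, hb2⟩ := g
  rw [Uf, show b - a⁻¹ = (a * b - 1) / a by field_simp]; field_simp
theorem R41 (g : Gen2 a b) : Rf q b a⁻¹ = (a * b - q) / (a * b - 1) := by
  obtain ⟨ha, hb, hab, hm, ha2, hb2⟩ := g
  rw [Rf, show b - a⁻¹ = (a * b - 1) / a by field_simp]; field_simp
theorem U32 (g : Gen2 a b) : Uf q b⁻¹ a = - (1 - q) / (a * b - 1) := by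
  obtain ⟨ha, hb, hab, hm, ha2, hb2⟩ := g
  rw [Uf, show b⁻¹ - a = -((a * b - 1) / b) by field_simp; ring]; field_simp
theorem R32 (g : Gen2 a b) : Rf q b⁻¹ a = (q * (a * b) - 1) / (a * b - 1) := by
  obtain ⟨ha, hb, hab, hm, ha2, hb2⟩ := g
  rw [Rf, show b⁻¹ - a = -((a * b - 1) / b) by field_simp; ring]; field_simp; ring
theorem U42 (g : Gen2 a b) : Uf q b a = - (1 - q) * b / (a - b) := by
  obtain ⟨ha, hb, hab, hm, ha2, hb2⟩ := g
  rw [Uf, ← neg_sub a b]; field_simp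
theorem R42 (g : Gen2 a b) : Rf q b a = (q * a - b) / (a - b) := by
  obtain ⟨ha, hb, hab, hm, ha2, hb2⟩ := g
  rw [Rf, ← neg_sub a b]; field_simp; ring

theorem xi34_12 (g : Gen2 a b) : (xi34 q a⁻¹ a b⁻¹ b).a12 = (1 - q) ^ 2 * (a * b) *
    ((1 + q) ^ 2 * (a * b) - q * (a ^ 2 + 1) * (b ^ 2 + 1)) / ((a - b) ^ 2 * (a * b - 1) ^ 2) := by
  obtain ⟨ha, hb, hab, hm, ha2, hb2⟩ := g
  simp only [xi34]
  rw [show b⁻¹ - a⁻¹ = (a - b) / (a * b) by field_simp,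
    show b - a⁻¹ = (a * b - 1) / a by field_simp,
    show b⁻¹ - a = -((a * b - 1) / b) by field_simp; ring, ← neg_sub a b]
  field_simp
  ring

theorem xi34_13 (g : Gen2 a b) : (xi34 q a⁻¹ a b⁻¹ b).a13 =
    (1 - q) * (a * b) / (a * b - 1) * (
      (b / a) * ((1 - q) * a / (a - b)) * ((q * (a * b) - 1) / (a * b - 1))
      + (a / b) * (- (1 - q) * b / (a - b)) * ((q * (a * b) - 1) / (a * b - 1))
      + (1 - q) * (a * b) * (- (1 - q) / (a * b - 1)) + 1) := by
  have e31 := U31 q g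
  have e32 := U32 q g
  have e42 := U42 q g
  have f32 := R32 q g
  obtain ⟨ha, hb, hab, hm, ha2, hb2⟩ := g
  simp only [xi34, e31, e32, e42, f32]
  rw [show b⁻¹ * (b - a⁻¹) = (a * b - 1) / (a * b) by field_simp]
  field_simp

/-- The decomposition coefficients: `s u` is the common factor attached to the
eigenvalue `u`. -/
def Qf (q y : F) : F := (y ^ 2 - q) / (y ^ 2 - 1)

def Mf (q a b : F) : F := (a - q * b) * (q * a - b) * (a * b - q) * (q * (a * b) - 1) /
  ((a - b) ^ 2 * (a * b - 1) ^ 2)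

theorem Qf_inv (g : Gen2 a b) : Qf q a⁻¹ = (q * a ^ 2 - 1) / (a ^ 2 - 1) := by
  obtain ⟨ha, hb, hab, hm, ha2, hb2⟩ := g
  rw [Qf, show a⁻¹ ^ 2 - 1 = -((a ^ 2 - 1) / a ^ 2) by field_simp; ring]
  field_simp
  ring

theorem Qf_inv' (g : Gen2 a b) : Qf q b⁻¹ = (q * b ^ 2 - 1) / (b ^ 2 - 1) := by
  obtain ⟨ha, hb, hab, hm, ha2, hb2⟩ := g
  rw [Qf, show b⁻¹ ^ 2 - 1 = -((b ^ 2 - 1) / b ^ 2) by field_simp; ring]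
  field_simp
  ring

/-- Decomposition of the bend covector with prescribed coefficients. -/
def decomp (q a b s13 s14 s23 s24 E : F) : V6 F :=
  ad6 (sm6 (E * Mf q a b) xi12)
  (ad6 (sm6 (s13 * ((q * a ^ 2 - 1) / (a ^ 2 - 1)) * ((q * b ^ 2 - 1) / (b ^ 2 - 1)))
    (xi13 q a b⁻¹))
  (ad6 (sm6 (s14 * ((q * a ^ 2 - 1) / (a ^ 2 - 1))) (xi14 q a b⁻¹ b))
  (ad6 (sm6 (s23 * ((q * b ^ 2 - 1) / (b ^ 2 - 1))) (xi23 q a⁻¹ a b⁻¹))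
  (ad6 (sm6 s24 (xi24 q a⁻¹ a b⁻¹ b)) (sm6 E (xi34 q a⁻¹ a b⁻¹ b))))))

theorem decomp_1a (g : Gen2 a b) (κ E Y : F) (hY : q ^ 2 * (E - κ) = Y - κ) :
    (⟨Y, κ, κ, κ, κ, E⟩ : V6 F) = decomp q a b
      (κ - E * (1 - q) * (a * b) / (a * b - 1)) (κ - E * (1 - q) * a / (a - b))
      (κ + E * (1 - q) * b / (a - b)) (κ + E * (1 - q) / (a * b - 1)) E := by
  obtain rfl : Y = q ^ 2 * (E - κ) + κ := by linear_combination -hY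
  simp only [decomp, ad6, sm6, V6.mk.injEq, xi34_12 q g, xi34_13 q g]
  simp only [xi12, xi13, xi14, xi23, xi24, xi34, U21 q g, R21 q g, U43 q g, R43 q g,
    U31 q g, U41 q g, U32 q g, R32 q g, U42 q g, Mf]
  obtain ⟨ha, hb, hab, hm, ha2, hb2⟩ := g
  refine ⟨?_, ?_, ?_, ?_, ?_, ?_⟩ <;> first | trivial | ring1 | (field_simp; done) | (field_simp; ring1)

theorem decomp_2b (g : Gen2 a b) (κ E Y : F) (hY : q ^ 3 * κ + q ^ 2 * E - q * κ - Y = 0) :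
    (⟨Y, q ^ 2 * κ * (a * b), q * κ * a / b, q * κ * b / a, κ / (a * b), E⟩ : V6 F) = decomp q a b
      (κ * (a * b) - E * (1 - q) * (a * b) / (a * b - 1)) (κ * a / b - E * (1 - q) * a / (a - b))
      (κ * b / a + E * (1 - q) * b / (a - b)) (κ / (a * b) + E * (1 - q) / (a * b - 1)) E := by
  obtain rfl : Y = q ^ 3 * κ + q ^ 2 * E - q * κ := by linear_combination -hY
  simp only [decomp, ad6, sm6, V6.mk.injEq, xi34_12 q g, xi34_13 q g]
  simp only [xi12, xi13, xi14, xi23, xi24, xi34, U21 q g, R21 q g, U43 q g, R43 q g,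
    U31 q g, U41 q g, U32 q g, R32 q g, U42 q g, Mf]
  obtain ⟨ha, hb, hab, hm, ha2, hb2⟩ := g
  have hm' : b * a - 1 ≠ 0 := by rwa [mul_comm]
  refine ⟨?_, ?_, ?_, ?_, ?_, ?_⟩ <;> first | trivial | ring1 | (field_simp; done) | (field_simp; ring1)

end
end

/-! ### Matching with the Weyl group sums -/

section
variable {F : Type} [Field F]

/-- Generic-field versions of the summands. -/
def gT (q u v : F) : F :=
  ((1 - q * (v / u)) / (1 - v / u)) *
  ((1 - q * (u * v)⁻¹) / (1 - (u * v)⁻¹)) *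
  ((1 - q * (u ^ 2)⁻¹) / (1 - (u ^ 2)⁻¹)) *
  ((1 - q * (v ^ 2)⁻¹) / (1 - (v ^ 2)⁻¹))

def gE1 (q : F) (l1 l2 : ℕ) (u v : F) : F :=
  u ^ (l1 + 1) * v ^ (l2 + 1) *
  ((u - q * v) / (u - v)) *
  ((v - q * u⁻¹) / (v - u⁻¹)) *
  ((1 - q) * v⁻¹ / (u - v⁻¹)) *
  ((u - q * u⁻¹) / (u - u⁻¹)) *
  ((v - q * v⁻¹) / (v - v⁻¹))

def gE2 (q : F) (k : ℕ) (u v : F) : F :=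
  u ^ k *
  ((u - q * v) / (u - v)) *
  ((u⁻¹ - q * v) / (u⁻¹ - v)) *
  ((u - q * v⁻¹) / (u - v⁻¹)) *
  ((u⁻¹ - q * v⁻¹) / (u⁻¹ - v⁻¹)) *
  ((u - q * u⁻¹) / (u - u⁻¹))

def Jf (q u v : F) : F := (u * v - q) / (u * v - 1) * Qf q u * Qf q v * (u * v)

theorem Jf_comm (q u v : F) : Jf q v u = Jf q u v := by
  simp only [Jf]; rw [mul_comm v u]; ring

theorem Gen2.swap {a b : F} (g : Gen2 a b) : Gen2 b a := by
  obtain ⟨ha, hb, hab, hm, ha2, hb2⟩ := g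
  exact ⟨hb, ha, by rw [← neg_sub]; exact neg_ne_zero.2 hab, by rwa [mul_comm], hb2, ha2⟩

theorem Gen2.inv {a b : F} (g : Gen2 a b) : Gen2 a⁻¹ b := by
  obtain ⟨ha, hb, hab, hm, ha2, hb2⟩ := g
  refine ⟨inv_ne_zero ha, hb, ?_, ?_, ?_, hb2⟩
  · rw [show a⁻¹ - b = -(a * b - 1) / a by field_simp; ring]
    exact div_ne_zero (neg_ne_zero.2 hm) ha
  · rw [show a⁻¹ * b - 1 = -(a - b) / a by field_simp; ring]
    exact div_ne_zero (neg_ne_zero.2 hab) ha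
  · rw [show a⁻¹ ^ 2 - 1 = -(a ^ 2 - 1) / a ^ 2 by field_simp; ring]
    exact div_ne_zero (neg_ne_zero.2 ha2) (pow_ne_zero 2 ha)

theorem gT_eq (q : F) {u v : F} (g : Gen2 u v) :
    gT q u v * (u * v) = Rf q u v * Jf q u v := by
  obtain ⟨ha, hb, hab, hm, ha2, hb2⟩ := g
  simp only [gT, Rf, Jf, Qf]
  rw [show 1 - v / u = (u - v) / u by field_simp,
    show 1 - (u * v)⁻¹ = (u * v - 1) / (u * v) by field_simp,
    show 1 - (u ^ 2)⁻¹ = (u ^ 2 - 1) / u ^ 2 by field_simp,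
    show 1 - (v ^ 2)⁻¹ = (v ^ 2 - 1) / v ^ 2 by field_simp]
  field_simp

theorem gE1_eq (q : F) {u v : F} (g : Gen2 u v) (n k : ℕ) :
    gE1 q (n + k) n u v = (u * v) ^ n * u ^ k * Rf q u v * Jf q u v * ((1 - q) / (u * v - 1)) := by
  obtain ⟨ha, hb, hab, hm, ha2, hb2⟩ := g
  have h : u ^ (n + k + 1) * v ^ (n + 1) = (u * v) ^ n * u ^ k * (u * v) := by ring
  simp only [gE1, Rf, Jf, Qf]
  rw [h, sub_inv_form ha, sub_inv_form hb,
    show v - u⁻¹ = (u * v - 1) / u by field_simp,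
    show u - v⁻¹ = (u * v - 1) / v by field_simp]
  field_simp

theorem gE2_eq (q : F) {u v : F} (g : Gen2 u v) (k : ℕ) :
    gE2 q k u v = u ^ k * Rf q u u⁻¹ * Mf q u v := by
  obtain ⟨ha, hb, hab, hm, ha2, hb2⟩ := g
  simp only [gE2, Rf, Mf]
  rw [sub_inv_form ha,
    show u⁻¹ - v = -((u * v - 1) / u) by field_simp; ring,
    show u⁻¹ - v⁻¹ = -((u - v) / (u * v)) by field_simp; ring,
    show u - v⁻¹ = (u * v - 1) / v by field_simp]
  field_simp
  ring

theorem Mf_comm (q u v : F) : Mf q v u = Mf q u v := by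
  simp only [Mf]
  rw [mul_comm v u, show (v - u) ^ 2 = (u - v) ^ 2 by ring]
  ring

theorem Mf_inv (q : F) {u v : F} (g : Gen2 u v) : Mf q u⁻¹ v = Mf q u v := by
  obtain ⟨ha, hb, hab, hm, ha2, hb2⟩ := g
  simp only [Mf]
  rw [show u⁻¹ - v = -((u * v - 1) / u) by field_simp; ring,
    show u⁻¹ * v - 1 = -((u - v) / u) by field_simp; ring]
  field_simp
  ring

/-- Sum of a function of two parameters over the Weyl group. -/
def W8 (f : F → F → F) (a b : F) : F :=
  f a b + f a⁻¹ b + f a b⁻¹ + f a⁻¹ b⁻¹ + f b a + f b⁻¹ a + f b a⁻¹ + f b⁻¹ a⁻¹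

section
variable (q : F) {a b : F}

theorem X24 (g : Gen2 a b) :
    a * b * Rf q a a⁻¹ * Rf q b a⁻¹ * Rf q b b⁻¹ = Jf q a b := by
  rw [R21 q g, R41 q g, R43 q g]; simp only [Jf, Qf]; ring

theorem X14 (g : Gen2 a b) :
    (q * a ^ 2 - 1) / (a ^ 2 - 1) * (a⁻¹ * b * Rf q b a * Rf q b b⁻¹) = Jf q a⁻¹ b := by
  rw [R42 q g, R43 q g, Jf, Qf_inv q g, Qf]
  obtain ⟨ha, hb, hab, hm, ha2, hb2⟩ := g
  rw [show a⁻¹ * b - 1 = -((a - b) / a) by field_simp; ring]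
  field_simp
  ring

theorem X23 (g : Gen2 a b) :
    (q * b ^ 2 - 1) / (b ^ 2 - 1) * (a * b⁻¹ * Rf q a a⁻¹ * Rf q b⁻¹ a⁻¹) = Jf q a b⁻¹ := by
  rw [R21 q g, R31 q g, Jf, Qf_inv' q g, Qf]
  obtain ⟨ha, hb, hab, hm, ha2, hb2⟩ := g
  rw [show a * b⁻¹ - 1 = (a - b) / b by field_simp]
  field_simp

theorem X13 (g : Gen2 a b) :
    (q * a ^ 2 - 1) / (a ^ 2 - 1) * ((q * b ^ 2 - 1) / (b ^ 2 - 1)) * (a⁻¹ * b⁻¹ * Rf q b⁻¹ a)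
      = Jf q a⁻¹ b⁻¹ := by
  rw [R32 q g, Jf, Qf_inv' q g, Qf_inv q g]
  obtain ⟨ha, hb, hab, hm, ha2, hb2⟩ := g
  rw [show a⁻¹ * b⁻¹ - 1 = -((a * b - 1) / (a * b)) by field_simp; ring]
  field_simp
  ring

theorem X34 (g : Gen2 a b) :
    b⁻¹ * b * Rf q b⁻¹ a⁻¹ * Rf q b⁻¹ a * Rf q b a⁻¹ * Rf q b a = Mf q a b := by
  rw [R31 q g, R32 q g, R41 q g, R42 q g, Mf]
  obtain ⟨ha, hb, hab, hm, ha2, hb2⟩ := g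
  field_simp

theorem Amp_decomp (g : Gen2 a b) (n k : ℕ) (c s13 s14 s23 s24 E : F)
    (hc : c = if k = 0 then 1 + q else 1) (hc0 : c ≠ 0) :
    Amp q a⁻¹ a b⁻¹ b n k (decomp q a b s13 s14 s23 s24 E) = c⁻¹ * (
      s13 * Jf q a⁻¹ b⁻¹ * (a⁻¹ * b⁻¹) ^ n * (a⁻¹ ^ k * Rf q a⁻¹ b⁻¹ + b⁻¹ ^ k * Rf q b⁻¹ a⁻¹)
      + s14 * Jf q a⁻¹ b * (a⁻¹ * b) ^ n * (a⁻¹ ^ k * Rf q a⁻¹ b + b ^ k * Rf q b a⁻¹)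
      + s23 * Jf q a b⁻¹ * (a * b⁻¹) ^ n * (a ^ k * Rf q a b⁻¹ + b⁻¹ ^ k * Rf q b⁻¹ a)
      + s24 * Jf q a b * (a * b) ^ n * (a ^ k * Rf q a b + b ^ k * Rf q b a)
      + E * Mf q a b * (a⁻¹ ^ k * Rf q a⁻¹ a + a ^ k * Rf q a a⁻¹
        + b⁻¹ ^ k * Rf q b⁻¹ b + b ^ k * Rf q b b⁻¹)) := by
  have gg := g.gen
  simp only [decomp, Amp_ad, Amp_sm]
  rw [Amp_xi12 q gg n k c hc hc0, Amp_xi13 q gg n k c hc hc0, Amp_xi14 q gg n k c hc hc0,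
    Amp_xi23 q gg n k c hc hc0, Amp_xi24 q gg n k c hc hc0, Amp_xi34 q gg n k c hc hc0]
  rw [X34 q g, X24 q g, ← X14 q g, ← X23 q g, ← X13 q g, inv_mul_cancel₀ g.ha,
    inv_mul_cancel₀ g.hb, one_pow]
  generalize Rf q a⁻¹ b⁻¹ = r1
  generalize Rf q b⁻¹ a⁻¹ = r2
  generalize Rf q a⁻¹ b = r3
  generalize Rf q b a⁻¹ = r4
  generalize Rf q a b⁻¹ = r5
  generalize Rf q b⁻¹ a = r6
  ring

theorem E2_sum (h2 : (2 : F) ≠ 0) (g : Gen2 a b) (k : ℕ) :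
    2⁻¹ * W8 (gE2 q k) a b = Mf q a b * (a⁻¹ ^ k * Rf q a⁻¹ a + a ^ k * Rf q a a⁻¹
        + b⁻¹ ^ k * Rf q b⁻¹ b + b ^ k * Rf q b b⁻¹) := by
  have g1 := g.inv
  have g2 := g.swap.inv
  have g3 := g.swap.inv.swap.inv
  simp only [W8]
  rw [gE2_eq q g, gE2_eq q g.inv, gE2_eq q g.swap.inv.swap, gE2_eq q g.swap.inv.swap.inv,
    gE2_eq q g.swap, gE2_eq q g.swap.inv, gE2_eq q g.inv.swap, gE2_eq q g.inv.swap.inv]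
  have e1 : Mf q a⁻¹ b = Mf q a b := Mf_inv q g
  have e2 : Mf q a b⁻¹ = Mf q a b := by rw [Mf_comm, Mf_inv q g.swap, Mf_comm]
  have e3 : Mf q a⁻¹ b⁻¹ = Mf q a b := by rw [Mf_inv q g.swap.inv.swap, e2]
  rw [Mf_comm q a b, Mf_comm q a b⁻¹, Mf_comm q a⁻¹ b, Mf_comm q a⁻¹ b⁻¹, e1, e2, e3,
    inv_inv, inv_inv]
  field_simp
  ring

theorem T1_eq (g : Gen2 a b) (n k : ℕ) : a ^ (n + k + 1) * b ^ (n + 1) * gT q a b =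
    (a * b) ^ n * a ^ k * Rf q a b * Jf q a b := by
  linear_combination (a * b) ^ n * a ^ k * gT_eq q g

theorem T0_eq (g : Gen2 a b) (n k : ℕ) : a ^ (n + k) * b ^ n * gT q a b =
    (a * b) ^ n * a ^ k * Rf q a b * Jf q a b / (a * b) := by
  rw [eq_div_iff (mul_ne_zero g.ha g.hb)]
  linear_combination (a * b) ^ n * a ^ k * gT_eq q g

theorem final_1a (h2 : (2 : F) ≠ 0) (g : Gen2 a b) (n k : ℕ) (c κ E Y : F)
    (hc : c = if k = 0 then 1 + q else 1) (hc0 : c ≠ 0) (hY : q ^ 2 * (E - κ) = Y - κ) :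
    Amp q a⁻¹ a b⁻¹ b n k ⟨Y, κ, κ, κ, κ, E⟩ =
      κ / c * W8 (fun u v => u ^ (n + k + 1) * v ^ (n + 1) * gT q u v) a b
      + E / c * (W8 (gE1 q (n + k) n) a b + 2⁻¹ * W8 (gE2 q k) a b) := by
  rw [decomp_1a q g κ E Y hY, Amp_decomp q g n k c _ _ _ _ _ hc hc0, E2_sum q h2 g]
  have s13 : κ - E * (1 - q) * (a * b) / (a * b - 1) =
      κ + E * ((1 - q) / (a⁻¹ * b⁻¹ - 1)) := by
    obtain ⟨ha, hb, hab, hm, ha2, hb2⟩ := g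
    rw [show a⁻¹ * b⁻¹ - 1 = -((a * b - 1) / (a * b)) by field_simp; ring]
    field_simp
    ring
  have s14 : κ - E * (1 - q) * a / (a - b) = κ + E * ((1 - q) / (a⁻¹ * b - 1)) := by
    obtain ⟨ha, hb, hab, hm, ha2, hb2⟩ := g
    rw [show a⁻¹ * b - 1 = -((a - b) / a) by field_simp; ring]
    field_simp
    ring
  have s23 : κ + E * (1 - q) * b / (a - b) = κ + E * ((1 - q) / (a * b⁻¹ - 1)) := by
    obtain ⟨ha, hb, hab, hm, ha2, hb2⟩ := g
    rw [show a * b⁻¹ - 1 = (a - b) / b by field_simp]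
    field_simp
  have s24 : κ + E * (1 - q) / (a * b - 1) = κ + E * ((1 - q) / (a * b - 1)) := by ring
  rw [s13, s14, s23, s24]
  simp only [W8]
  rw [gE1_eq q g, gE1_eq q g.inv, gE1_eq q g.swap.inv.swap, gE1_eq q g.swap.inv.swap.inv,
    gE1_eq q g.swap, gE1_eq q g.swap.inv, gE1_eq q g.inv.swap, gE1_eq q g.inv.swap.inv]
  rw [T1_eq q g, T1_eq q g.inv, T1_eq q g.swap.inv.swap, T1_eq q g.swap.inv.swap.inv,
    T1_eq q g.swap, T1_eq q g.swap.inv, T1_eq q g.inv.swap, T1_eq q g.inv.swap.inv]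
  rw [Jf_comm q a b, Jf_comm q a b⁻¹, Jf_comm q a⁻¹ b, Jf_comm q a⁻¹ b⁻¹,
    mul_comm b a, mul_comm b⁻¹ a, mul_comm b a⁻¹, mul_comm b⁻¹ a⁻¹]
  generalize (1 - q) / (a * b - 1) = w1
  generalize (1 - q) / (a⁻¹ * b - 1) = w2
  generalize (1 - q) / (a * b⁻¹ - 1) = w3
  generalize (1 - q) / (a⁻¹ * b⁻¹ - 1) = w4
  ring

theorem final_2b (h2 : (2 : F) ≠ 0) (g : Gen2 a b) (n k : ℕ) (c κ E Y : F)
    (hc : c = if k = 0 then 1 + q else 1) (hc0 : c ≠ 0)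
    (hY : q ^ 3 * κ + q ^ 2 * E - q * κ - Y = 0) :
    Amp q a⁻¹ a b⁻¹ b n k
      ⟨Y, q ^ 2 * κ * (a * b), q * κ * a / b, q * κ * b / a, κ / (a * b), E⟩ =
      κ / c * W8 (fun u v => u ^ (n + k) * v ^ n * gT q u v) a b
      + E / c * (W8 (gE1 q (n + k) n) a b + 2⁻¹ * W8 (gE2 q k) a b) := by
  rw [decomp_2b q g κ E Y hY, Amp_decomp q g n k c _ _ _ _ _ hc hc0, E2_sum q h2 g]
  have s13 : κ * (a * b) - E * (1 - q) * (a * b) / (a * b - 1) =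
      κ / (a⁻¹ * b⁻¹) + E * ((1 - q) / (a⁻¹ * b⁻¹ - 1)) := by
    obtain ⟨ha, hb, hab, hm, ha2, hb2⟩ := g
    rw [show a⁻¹ * b⁻¹ - 1 = -((a * b - 1) / (a * b)) by field_simp; ring]
    field_simp
    ring
  have s14 : κ * a / b - E * (1 - q) * a / (a - b) =
      κ / (a⁻¹ * b) + E * ((1 - q) / (a⁻¹ * b - 1)) := by
    obtain ⟨ha, hb, hab, hm, ha2, hb2⟩ := g
    rw [show a⁻¹ * b - 1 = -((a - b) / a) by field_simp; ring]
    field_simp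
    ring
  have s23 : κ * b / a + E * (1 - q) * b / (a - b) =
      κ / (a * b⁻¹) + E * ((1 - q) / (a * b⁻¹ - 1)) := by
    obtain ⟨ha, hb, hab, hm, ha2, hb2⟩ := g
    rw [show a * b⁻¹ - 1 = (a - b) / b by field_simp]
    field_simp
  have s24 : κ / (a * b) + E * (1 - q) / (a * b - 1) =
      κ / (a * b) + E * ((1 - q) / (a * b - 1)) := by ring
  rw [s13, s14, s23, s24]
  simp only [W8]
  rw [gE1_eq q g, gE1_eq q g.inv, gE1_eq q g.swap.inv.swap, gE1_eq q g.swap.inv.swap.inv,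
    gE1_eq q g.swap, gE1_eq q g.swap.inv, gE1_eq q g.inv.swap, gE1_eq q g.inv.swap.inv]
  rw [T0_eq q g, T0_eq q g.inv, T0_eq q g.swap.inv.swap, T0_eq q g.swap.inv.swap.inv,
    T0_eq q g.swap, T0_eq q g.swap.inv, T0_eq q g.inv.swap, T0_eq q g.inv.swap.inv]
  rw [Jf_comm q a b, Jf_comm q a b⁻¹, Jf_comm q a⁻¹ b, Jf_comm q a⁻¹ b⁻¹,
    mul_comm b a, mul_comm b⁻¹ a, mul_comm b a⁻¹, mul_comm b⁻¹ a⁻¹]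
  generalize (1 - q) / (a * b - 1) = w1
  generalize (1 - q) / (a⁻¹ * b - 1) = w2
  generalize (1 - q) / (a * b⁻¹ - 1) = w3
  generalize (1 - q) / (a⁻¹ * b⁻¹ - 1) = w4
  generalize Jf q a b = j1
  generalize Jf q a⁻¹ b = j2
  generalize Jf q a b⁻¹ = j3
  generalize Jf q a⁻¹ b⁻¹ = j4
  ring

end
end

/-! ### Specialisation to the field of rational functions -/

theorem sum_bool2 (f : (Fin 2 → Bool) → F2) :
    ∑ h, f h = ∑ a : Bool, ∑ b : Bool, f ![a, b] := by
  let e : Bool × Bool ≃ (Fin 2 → Bool) :=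
    { toFun := fun p => ![p.1, p.2]
      invFun := fun h => (h 0, h 1)
      left_inv := fun p => rfl
      right_inv := fun h => by funext i; fin_cases i <;> rfl }
  rw [← e.sum_comp]
  simp only [Fintype.sum_prod_type]
  rfl

theorem sum_perm2 (f : Equiv.Perm (Fin 2) → F2) :
    ∑ σ, f σ = f 1 + f (Equiv.swap 0 1) := by
  have h : (Finset.univ : Finset (Equiv.Perm (Fin 2))) = {1, Equiv.swap 0 1} := by decide
  rw [h, Finset.sum_pair (by decide)]

theorem WSum2_eq (g : (Fin 2 → F2) → F2) (f : F2 → F2 → F2) (h : ∀ y, g y = f (y 0) (y 1)) :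
    WSum2 g = W8 f (x2v 0) (x2v 1) := by
  simp only [WSum2, sum_perm2, sum_bool2, Fintype.sum_bool, h, W8]
  simp
  ring

theorem ne_of_eval (p : MvPolynomial (Fin 3) ℂ) (v : Fin 3 → ℂ) (h : MvPolynomial.eval v p ≠ 0) :
    algebraMap (MvPolynomial (Fin 3) ℂ) F2 p ≠ 0 := by
  intro h0
  have : p = 0 := (IsFractionRing.injective (MvPolynomial (Fin 3) ℂ) F2) (by rw [h0, map_zero])
  exact h (by rw [this, map_zero])

theorem gen2_x2v : Gen2 (x2v 0) (x2v 1) := by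
  refine ⟨?_, ?_, ?_, ?_, ?_, ?_⟩
  · exact ne_of_eval _ (fun _ => 1) (by simp)
  · exact ne_of_eval _ (fun _ => 1) (by simp)
  · rw [x2v, x2v, ← map_sub]
    exact ne_of_eval _ ![0, 1, 0] (by simp)
  · rw [x2v, x2v, ← map_mul, ← map_one (algebraMap (MvPolynomial (Fin 3) ℂ) F2), ← map_sub]
    exact ne_of_eval _ (fun _ => 0) (by simp)
  · rw [x2v, ← map_pow, ← map_one (algebraMap (MvPolynomial (Fin 3) ℂ) F2), ← map_sub]
    exact ne_of_eval _ (fun _ => 0) (by simp)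
  · rw [x2v, ← map_pow, ← map_one (algebraMap (MvPolynomial (Fin 3) ℂ) F2), ← map_sub]
    exact ne_of_eval _ (fun _ => 0) (by simp)

theorem two_ne_F2 : (2 : F2) ≠ 0 := by
  rw [← map_ofNat (algebraMap (MvPolynomial (Fin 3) ℂ) F2) 2]
  exact ne_of_eval _ (fun _ => 0) (by rw [map_ofNat]; exact two_ne_zero)

theorem one_add_q2_ne : 1 + q2 ≠ 0 := by
  rw [q2, ← map_one (algebraMap (MvPolynomial (Fin 3) ℂ) F2), ← map_add]
  exact ne_of_eval _ (fun _ => 0) (by simp)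

/-- Rank-two evaluation (Theorem 6.2), regimes 1(a) and 2(b). -/
theorem stmt12 (l1 l2 : ℕ) (hl : l2 ≤ l1) (A B C D : Fin 2 → F2) :
    (((∀ i, B i = C i) ∧ (∀ i, IsPolyQ2 (A i)) ∧ (∀ i, IsPolyQ2 (C i)) ∧
        (∀ i, IsPolyQ2 (D i)) ∧ (∀ i, C i ≠ 0) ∧
        q2 ^ 2 * (A 0 * D 1 - C 0 * C 1) = A 1 * D 0 - C 0 * C 1) →
      ZBC ![l1, l2] l1 q2 x2v A B C D
        = (C 0 * C 1 / (if l1 = l2 then 1 + q2 else 1)) *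
            WSum2 (fun y => y 0 ^ (l1 + 1) * y 1 ^ (l2 + 1) * Tprod2 y)
          + (A 0 * D 1 / (if l1 = l2 then 1 + q2 else 1)) *
            (WSum2 (E1 l1 l2) + (2 : F2)⁻¹ * WSum2 (E2 l1 l2))) ∧
    (∀ m1 m2 : F2, IsPolyQ2 m1 → IsPolyQ2 m2 → m1 ≠ 0 → m2 ≠ 0 →
      C 0 = m1 * (x2v 0)⁻¹ → C 1 = m2 * (x2v 1)⁻¹ →
      B 0 = q2 * m1 * x2v 0 → B 1 = q2 * m2 * x2v 1 →
      (∀ i, IsPolyQ2 (A i)) → (∀ i, IsPolyQ2 (D i)) →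
      q2 ^ 3 * (m1 * m2) + q2 ^ 2 * (D 1 * A 0) - q2 * (m1 * m2) - A 1 * D 0 = 0 →
      ZBC ![l1, l2] l1 q2 x2v A B C D
        = (m1 * m2 / (if l1 = l2 then 1 + q2 else 1)) *
            WSum2 (fun y => y 0 ^ l1 * y 1 ^ l2 * Tprod2 y)
          + (A 0 * D 1 / (if l1 = l2 then 1 + q2 else 1)) *
            (WSum2 (E1 l1 l2) + (2 : F2)⁻¹ * WSum2 (E2 l1 l2))) := by
  obtain ⟨k, rfl⟩ := Nat.exists_eq_add_of_le hl
  have hif : (if l2 + k = l2 then 1 + q2 else 1) = if k = 0 then 1 + q2 else 1 := by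
    simp
  have hc0 : (if k = 0 then 1 + q2 else 1) ≠ 0 := by
    split_ifs
    · exact one_add_q2_ne
    · exact one_ne_zero
  have hE1 : WSum2 (E1 (l2 + k) l2) = W8 (gE1 q2 (l2 + k) l2) (x2v 0) (x2v 1) :=
    WSum2_eq _ _ (fun y => rfl)
  have hE2 : WSum2 (E2 (l2 + k) l2) = W8 (gE2 q2 k) (x2v 0) (x2v 1) :=
    WSum2_eq _ _ (fun y => by rw [E2, Nat.add_sub_cancel_left]; rfl)
  have g := gen2_x2v
  rw [hif, hE1, hE2, ZBC_Amp]
  refine ⟨?_, ?_⟩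
  · rintro ⟨hB, -, -, -, -, hq⟩
    rw [WSum2_eq (fun y => y 0 ^ (l2 + k + 1) * y 1 ^ (l2 + 1) * Tprod2 y)
      (fun u v => u ^ (l2 + k + 1) * v ^ (l2 + 1) * gT q2 u v) (fun y => rfl),
      hB, hB]
    refine final_1a q2 two_ne_F2 g l2 k _ (C 0 * C 1) (A 0 * D 1) (D 0 * A 1) rfl hc0 ?_
    rw [hq, mul_comm (A 1)]
  · intro m1 m2 _ _ _ _ hC0 hC1 hB0 hB1 _ _ hq
    rw [WSum2_eq (fun y => y 0 ^ (l2 + k) * y 1 ^ l2 * Tprod2 y)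
      (fun u v => u ^ (l2 + k) * v ^ l2 * gT q2 u v) (fun y => rfl),
      ← final_2b q2 two_ne_F2 g l2 k _ (m1 * m2) (A 0 * D 1) (D 0 * A 1) rfl hc0
        (by linear_combination hq), hC0, hC1, hB0, hB1]
    have ha := g.ha
    have hb := g.hb
    congr 2
    · ring
    · field_simp
    · field_simp
    · field_simp
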